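/- Let (R, m) be a Noetherian complete local ring and let I ∈ 𝓘(R). Then mAss_R R/(p + I) = Assh_R R/(p + I) for every prime ideal p of R; that is, every minimal associated prime q of R/(p+I) satisfies dim R/q = dim R/(p+I). -/

import Mathlib

universe u

open CategoryTheory

/-- An `R`-module `L` is `I`-cofinite if `Supp L ⊆ V(I)` and `Ext^i_R(R/I, L)` is a finitely
generated `R`-module for all `i ≥ 0`. -/
def IsCofinite {R : Type u} [CommRing R] (I : Ideal R) (L : ModuleCat.{u} R) : Prop :=
  Module.support R L ⊆ PrimeSpectrum.zeroLocus (I : Set R) ∧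
    ∀ i : ℕ, Module.Finite R
      (((Ext R (ModuleCat.{u} R) i).obj (Opposite.op (ModuleCat.of R (R ⧸ I)))).obj L)

/-- `I ∈ 𝓘(R)`: for every finitely generated `R`-module `M`, the local cohomology modules
`H^i_I(M)` are `I`-cofinite for all `i ≥ 0`. -/
def MemCofiniteClass (R : Type u) [CommRing R] (I : Ideal R) : Prop :=
  ∀ M : ModuleCat.{u} R, Module.Finite R M →
    ∀ i : ℕ, IsCofinite I ((localCohomology I i).obj M)

universe v w

namespace CofPf
open IsLocalRing

/-- dimension of `R/p` as a natural number -/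
noncomputable def dd {R : Type u} [CommRing R] (p : Ideal R) : ℕ :=
  ((ringKrullDim (R ⧸ p)).unbotD 0).toNat

section dims
variable {R : Type u} [CommRing R] [IsNoetherianRing R] [IsLocalRing R]

lemma dd_coe (J : Ideal R) (hJ : J ≠ ⊤) : ringKrullDim (R ⧸ J) = (dd J : WithBot ℕ∞) := by
  have : Nontrivial (R ⧸ J) := Ideal.Quotient.nontrivial_iff.mpr hJ
  have h1 : ringKrullDim (R ⧸ J) ≠ ⊥ := by
    have := ringKrullDim_nonneg_of_nontrivial (R := R ⧸ J)
    intro h; rw [h] at this; simp at this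
  have h2 : ringKrullDim (R ⧸ J) < ⊤ :=
    lt_of_le_of_lt (ringKrullDim_quotient_le J) (ringKrullDim_lt_top (R := R))
  unfold dd
  obtain ⟨n, hn⟩ := WithBot.ne_bot_iff_exists.mp h1
  rw [← hn] at h2 ⊢
  have h3 : n ≠ ⊤ := by
    rintro rfl
    exact absurd h2 (by simp)
  obtain ⟨k, rfl⟩ := ENat.ne_top_iff_exists.mp h3
  simp

lemma exists_prime_dim (J : Ideal R) (hJ : J ≠ ⊤) :
    ∃ Q : Ideal R, Q.IsPrime ∧ J ≤ Q ∧ dd Q = dd J := by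
  have h := dd_coe J hJ
  rw [ringKrullDim_quotient] at h
  have hne : Nonempty (PrimeSpectrum.zeroLocus (R := R) J) := by
    rwa [Set.nonempty_coe_sort, Set.nonempty_iff_ne_empty, ne_eq,
      PrimeSpectrum.zeroLocus_empty_iff_eq_top]
  obtain ⟨l, hl⟩ := Order.le_krullDim_iff.mp h.ge
  refine ⟨l.head.1.asIdeal, l.head.1.2, l.head.2, ?_⟩
  apply le_antisymm
  · have h2 := ringKrullDim_le_of_surjective (Ideal.Quotient.factor (S := J) (T := l.head.1.asIdeal) l.head.2)
      (Ideal.Quotient.factor_surjective _)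
    rw [dd_coe _ hJ, dd_coe _ l.head.1.2.ne_top] at h2
    exact_mod_cast h2
  · have h2 : ((l.length : ℕ) : WithBot ℕ∞) ≤ Order.krullDim (PrimeSpectrum.zeroLocus (R := R) l.head.1.asIdeal) := by
      let l' : LTSeries (PrimeSpectrum.zeroLocus (R := R) l.head.1.asIdeal) :=
        { length := l.length
          toFun := fun i => ⟨(l i).1, fun x hx => (l.head_le i : l.head ≤ l i) hx⟩
          step := fun i => l.step i }
      exact Order.le_krullDim_iff.mpr ⟨l', rfl⟩
    rw [← ringKrullDim_quotient, dd_coe _ l.head.1.2.ne_top, hl] at h2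
    exact_mod_cast h2

lemma dd_lt {p q : Ideal R} (hp : p.IsPrime) (hq : q.IsPrime) (h : p < q) : dd q < dd p := by
  have h1 := dd_coe p hp.ne_top
  have h2 := dd_coe q hq.ne_top
  rw [ringKrullDim_quotient] at h1 h2
  obtain ⟨l, hl⟩ := Order.le_krullDim_iff.mp h2.ge
  let l1 : LTSeries (PrimeSpectrum.zeroLocus (R := R) p) :=
        { length := l.length
          toFun := fun i => ⟨(l i).1, fun x hx => (l i).2 (h.le hx)⟩
          step := fun i => l.step i }
  let l2 := l1.cons ⟨⟨p, hp⟩, le_refl p⟩ (by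
    show (⟨p, hp⟩ : PrimeSpectrum R) < (l.head).1
    exact lt_of_lt_of_le (b := (⟨q, hq⟩ : PrimeSpectrum R)) h (fun x hx => (l.head).2 hx))
  have : ((dd q + 1 : ℕ) : WithBot ℕ∞) ≤ (dd p : WithBot ℕ∞) := by
    rw [← h1]
    apply Order.le_krullDim_iff.mpr ⟨l2, ?_⟩
    simp [l2, l1, hl]
  have : dd q + 1 ≤ dd p := by exact_mod_cast this
  omega

lemma dd_le {p q : Ideal R} (hq : q ≠ ⊤) (h : p ≤ q) : dd q ≤ dd p := by
  have hp : p ≠ ⊤ := by rintro rfl; exact hq (top_le_iff.mp h)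
  have h2 := ringKrullDim_le_of_surjective (Ideal.Quotient.factor (S := p) (T := q) h)
      (Ideal.Quotient.factor_surjective _)
  rw [dd_coe _ hp, dd_coe _ hq] at h2
  exact_mod_cast h2

lemma exists_dd_succ {p : Ideal R} (hp : p.IsPrime) {x : R} (hx : x ∈ maximalIdeal R)
    (hxp : x ∉ p) : ∃ Q : Ideal R, Q.IsPrime ∧ p ≤ Q ∧ x ∈ Q ∧ dd Q + 1 = dd p := by
  have hJ : p ⊔ Ideal.span {x} ≠ ⊤ := by
    intro h
    have : p ⊔ Ideal.span {x} ≤ maximalIdeal R :=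
      sup_le (le_maximalIdeal hp.ne_top) ((Ideal.span_singleton_le_iff_mem _).mpr hx)
    rw [h] at this
    exact (maximalIdeal.isMaximal R).ne_top (top_le_iff.mp this)
  obtain ⟨Q, hQ, hJQ, hd⟩ := exists_prime_dim _ hJ
  refine ⟨Q, hQ, le_sup_left.trans hJQ, hJQ (Ideal.mem_sup_right (Ideal.mem_span_singleton_self x)), ?_⟩
  rw [hd]
  have : IsDomain (R ⧸ p) := Ideal.Quotient.isDomain p
  have : IsLocalRing (R ⧸ p) := IsLocalRing.of_surjective' (Ideal.Quotient.mk p) Ideal.Quotient.mk_surjective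
  have hx' : Ideal.Quotient.mk p x ∈ maximalIdeal (R ⧸ p) := by
    rw [mem_maximalIdeal, mem_nonunits_iff]
    intro hu
    obtain ⟨y, hy⟩ := hu.exists_right_inv
    obtain ⟨y, rfl⟩ := Ideal.Quotient.mk_surjective y
    rw [← map_mul, ← map_one (Ideal.Quotient.mk p), Ideal.Quotient.eq] at hy
    have h1 : x * y - 1 ∈ maximalIdeal R := le_maximalIdeal hp.ne_top hy
    have h2 : (1 : R) ∈ maximalIdeal R := by
      have := (maximalIdeal R).sub_mem ((maximalIdeal R).mul_mem_right y hx) h1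
      simpa using this
    exact (maximalIdeal.isMaximal R).ne_top ((Ideal.eq_top_iff_one _).mpr h2)
  have hreg : IsSMulRegular (R ⧸ p) (Ideal.Quotient.mk p x) := by
    apply IsSMulRegular.of_right_eq_zero_of_smul
    intro y hy
    have : Ideal.Quotient.mk p x ≠ 0 := by rwa [Ne, Ideal.Quotient.eq_zero_iff_mem]
    simpa [this] using hy
  have h1 := ringKrullDim_quotient_span_singleton_succ_eq_ringKrullDim hreg hx'
  have e : ((R ⧸ p) ⧸ Ideal.span {Ideal.Quotient.mk p x}) ≃+* R ⧸ (p ⊔ Ideal.span {x}) := by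
    refine (Ideal.quotEquivOfEq ?_).trans (DoubleQuot.quotQuotEquivQuotSup p (Ideal.span {x}))
    rw [Ideal.map_span, Set.image_singleton]
  rw [ringKrullDim_eq_of_ringEquiv e, dd_coe _ hJ, dd_coe _ hp.ne_top] at h1
  exact_mod_cast h1

end dims
end CofPf

namespace CofPf
open IsLocalRing

section complete
variable {R : Type u} [CommRing R] [IsNoetherianRing R] [IsLocalRing R]
  [IsAdicComplete (maximalIdeal R) R]

lemma complete_series (c : ℕ → R) {y : R} (hy : y ∈ maximalIdeal R) :
    ∃ s : ℕ → R, ∀ n, s n = c n + y * s (n + 1) := by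
  have key : ∀ n, ∃ L : R, ∀ k, (∑ i ∈ Finset.range k, y ^ i * c (n + i)) - L ∈ maximalIdeal R ^ k := by
    intro n
    obtain ⟨L, hL⟩ := IsPrecomplete.prec' (I := maximalIdeal R) (M := R)
      (fun k => ∑ i ∈ Finset.range k, y ^ i * c (n + i)) (by
      intro a b hab
      rw [SModEq.sub_mem, ← neg_mem_iff, neg_sub, ← Finset.sum_Ico_eq_sub _ hab]
      refine Submodule.sum_mem _ fun i hi => ?_
      simp only [smul_eq_mul, Ideal.mul_top]
      exact Ideal.mul_mem_right _ _ (Ideal.pow_le_pow_right (Finset.mem_Ico.mp hi).1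
        (Ideal.pow_mem_pow hy i)))
    refine ⟨L, fun k => ?_⟩
    have := hL k
    rw [SModEq.sub_mem] at this
    simpa using this
  choose s hs using key
  refine ⟨s, fun n => ?_⟩
  rw [← sub_eq_zero]
  refine IsHausdorff.haus' (I := maximalIdeal R) _ fun k => ?_
  rw [SModEq.sub_mem, sub_zero]
  have h1 := Ideal.pow_le_pow_right (Nat.le_succ k) (hs n (k+1))
  have h2 := hs (n+1) k
  have h3 : y * ((∑ i ∈ Finset.range k, y ^ i * c (n + 1 + i)) - s (n+1)) ∈ maximalIdeal R ^ k :=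
    Ideal.mul_mem_left _ _ h2
  have h4 := Ideal.sub_mem _ h3 h1
  rw [Finset.sum_range_succ'] at h4
  simp only [smul_eq_mul, Ideal.mul_top]
  convert h4 using 1
  rw [mul_sub, Finset.mul_sum]
  have : ∀ i, y ^ (i+1) * c (n + (i+1)) = y * (y ^ i * c (n+1+i)) := by
    intro i; rw [pow_succ', show n + (i+1) = n+1+i by ring]; ring
  simp only [this]
  simp
  ring

lemma finite_of_sep {V : Type v} [AddCommGroup V] [Module R V] {y : R} (hy : y ∈ maximalIdeal R)
    (hsep : ∀ u : ℕ → V, (∀ n, u n = y • u (n + 1)) → u 0 = 0)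
    {W : Type w} [AddCommGroup W] [Module R W] [Module.Finite R W] (f : V →ₗ[R] W)
    (hf : ∀ v, f v = 0 → ∃ v', v = y • v') : Module.Finite R V := by
  have hfin : (LinearMap.range f).FG := IsNoetherian.noetherian _
  obtain ⟨n, g, hg⟩ := Submodule.fg_iff_exists_fin_generating_family.mp hfin
  have hg' : ∀ i, ∃ e, f e = g i := fun i => by
    have : g i ∈ LinearMap.range f := hg ▸ Submodule.subset_span ⟨i, rfl⟩
    exact this
  choose e he using hg'
  have step : ∀ v : V, ∃ (c : Fin n → R) (v' : V), v = ∑ i, c i • e i + y • v' := by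
    intro v
    have : f v ∈ Submodule.span R (Set.range g) := hg ▸ ⟨v, rfl⟩
    obtain ⟨c, hc⟩ := (Submodule.mem_span_range_iff_exists_fun R).mp this
    obtain ⟨v', hv'⟩ := hf (v - ∑ i, c i • e i) (by simp [he, hc])
    exact ⟨c, v', by rw [← hv']; abel⟩
  choose c nx hnx using step
  refine ⟨Submodule.fg_def.mpr ⟨Set.range e, Set.finite_range e, ?_⟩⟩
  rw [eq_top_iff]
  rintro v -
  let vs : ℕ → V := fun n => nx^[n] v
  have hvs : ∀ k, vs k = ∑ i, c (vs k) i • e i + y • vs (k+1) := by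
    intro k
    have : vs (k+1) = nx (vs k) := Function.iterate_succ_apply' _ _ _
    rw [this]; exact hnx _
  have hser := fun i => complete_series (fun k => c (vs k) i) hy
  choose s hs using hser
  have hz := hsep (fun k => vs k - ∑ i, s i k • e i) (fun k => by
    conv_lhs => rw [hvs k]
    rw [smul_sub, Finset.smul_sum]
    have : ∀ i, s i k • e i = c (vs k) i • e i + y • s i (k+1) • e i := by
      intro i
      conv_lhs => rw [hs i k]
      rw [add_smul, mul_smul]
    simp only [this, Finset.sum_add_distrib]
    abel)
  have : v = ∑ i, s i 0 • e i := by
    have h0 : vs 0 = v := rfl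
    rw [← h0]; exact sub_eq_zero.mp hz
  rw [this]
  exact Submodule.sum_mem _ fun i _ => Submodule.smul_mem _ _ (Submodule.subset_span ⟨i, rfl⟩)

end complete

section kill
variable {R : Type u} [CommRing R]

/-- `V` is killed by some element outside `p`. -/
def Kill (p : Ideal R) (V : Type v) [AddCommGroup V] [Module R V] : Prop :=
  ∃ s, s ∉ p ∧ ∀ v : V, s • v = 0

variable {A : Type v} {B : Type w} {C : Type*} [AddCommGroup A] [AddCommGroup B] [AddCommGroup C]
  [Module R A] [Module R B] [Module R C] {p : Ideal R}

lemma Kill.of_inj (h : Kill p B) (f : A →ₗ[R] B) (hf : Function.Injective f) : Kill p A := by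
  obtain ⟨s, hs, h⟩ := h
  exact ⟨s, hs, fun v => hf (by rw [map_smul, h, map_zero])⟩

lemma Kill.of_surj (h : Kill p A) (f : A →ₗ[R] B) (hf : Function.Surjective f) : Kill p B := by
  obtain ⟨s, hs, h⟩ := h
  refine ⟨s, hs, fun v => ?_⟩
  obtain ⟨a, rfl⟩ := hf v
  rw [← map_smul, h, map_zero]

lemma Kill.of_equiv (h : Kill p A) (f : A ≃ₗ[R] B) : Kill p B := h.of_surj f.toLinearMap f.surjective

lemma Kill.mono {q : Ideal R} (h : Kill p A) (hq : q ≤ p) : Kill q A :=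
  let ⟨s, hs, h⟩ := h
  ⟨s, fun h' => hs (hq h'), h⟩

lemma Kill.mid (hp : p.IsPrime) (hA : Kill p A) (hC : Kill p C) (f : A →ₗ[R] B) (g : B →ₗ[R] C)
    (hfg : ∀ b, g b = 0 → ∃ a, f a = b) : Kill p B := by
  obtain ⟨s, hs, hA⟩ := hA
  obtain ⟨t, ht, hC⟩ := hC
  refine ⟨s * t, fun h => (hp.mem_or_mem h).elim hs ht, fun b => ?_⟩
  obtain ⟨a, ha⟩ := hfg (t • b) (by rw [map_smul, hC])
  rw [mul_smul, ← ha, ← map_smul, hA, map_zero]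

lemma Kill.of_subsingleton (hp : p ≠ ⊤) [Subsingleton A] : Kill p A :=
  ⟨1, fun h => hp ((Ideal.eq_top_iff_one _).mpr h), fun v => Subsingleton.elim _ _⟩

lemma kill_nak [Module.Finite R A] (hp : p.IsPrime) {I : Ideal R} (hI : I ≤ p) {s : R} (hs : s ∉ p)
    (h : ∀ v : A, s • v ∈ I • (⊤ : Submodule R A)) : Kill p A := by
  obtain ⟨P, hm, -, hc, h0⟩ :=
    LinearMap.exists_monic_and_natDegree_eq_and_coeff_mem_pow_and_aeval_eq_zero R
    (s • LinearMap.id : Module.End R A) I (by rintro _ ⟨v, rfl⟩; exact h v)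
  refine ⟨P.eval s, fun hmem => ?_, fun v => ?_⟩
  · rw [Polynomial.eval_eq_sum_range, Finset.sum_range_succ, hm.coeff_natDegree, one_mul] at hmem
    have h1 : ∑ i ∈ Finset.range P.natDegree, P.coeff i * s ^ i ∈ p := by
      refine Ideal.sum_mem _ fun i hi => Ideal.mul_mem_right _ _ (hI ?_)
      have := hc i
      exact Ideal.pow_le_self (by have := Finset.mem_range.mp hi; omega) this
    exact hs (hp.mem_of_pow_mem _ ((Ideal.add_mem_iff_right _ h1).mp hmem))
  · have := LinearMap.congr_fun h0 v
    have e : (s • LinearMap.id : Module.End R A) = algebraMap R (Module.End R A) s := rfl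
    rw [e, Polynomial.aeval_algebraMap_apply] at this
    simpa using this

end kill
end CofPf

namespace CofPf
open IsLocalRing CategoryTheory

lemma baer_of_injective_obj {R : Type u} [CommRing R] (J : ModuleCat.{u} R) [Injective J] :
    Module.Baer R J :=
  Module.Baer.of_injective (Module.injective_module_of_injective_object R J)

lemma injective_obj_of_baer {R : Type u} [CommRing R] (J : ModuleCat.{u} R) (h : Module.Baer R J) :
    Injective J := by
  have := h.injective
  exact Module.injective_object_of_injective_module R J

lemma exists_hull_aux {R : Type u} [CommRing R] {J : Type u} [AddCommGroup J] [Module R J]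
    (hJ : Module.Baer R J) (S0 : Submodule R J) :
    ∃ E : Submodule R J, S0 ≤ E ∧ (∀ x ∈ E, x ≠ 0 → ∃ r : R, r • x ≠ 0 ∧ r • x ∈ S0) ∧
      Module.Baer R E := by
  obtain ⟨E, hSE, hE⟩ := zorn_le_nonempty₀
    {E : Submodule R J | S0 ≤ E ∧ ∀ x ∈ E, x ≠ 0 → ∃ r : R, r • x ≠ 0 ∧ r • x ∈ S0} (by
    intro c hc hch y hy
    refine ⟨sSup c, ⟨(hc hy).1.trans (le_sSup hy), ?_⟩, fun z hz => le_sSup hz⟩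
    intro x hx
    rw [Submodule.mem_sSup_of_directed ⟨y, hy⟩ hch.directedOn] at hx
    obtain ⟨z, hz, hxz⟩ := hx
    exact (hc hz).2 x hxz) S0 ⟨le_rfl, fun x hx h => ⟨1, by simpa using h, by simpa using hx⟩⟩
  obtain ⟨C, -, hC⟩ := zorn_le_nonempty₀
    {C : Submodule R J | ∀ x ∈ C, x ∈ E → x = 0} (by
    intro c hc hch y hy
    refine ⟨sSup c, ?_, fun z hz => le_sSup hz⟩
    intro x hx hxE
    rw [Submodule.mem_sSup_of_directed ⟨y, hy⟩ hch.directedOn] at hx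
    obtain ⟨z, hz, hxz⟩ := hx
    exact hc hz x hxz hxE) ⊥ (by intro x hx _; simpa using hx)
  have hCd := hC.prop
  have hEd := hE.prop
  let j : E →ₗ[R] J ⧸ C := C.mkQ.comp E.subtype
  have hj : Function.Injective j := by
    rw [injective_iff_map_eq_zero]
    rintro ⟨x, hx⟩ h
    have : x ∈ C := by simpa [j] using h
    exact Subtype.ext (hCd x this hx)
  obtain ⟨h, hh⟩ := hJ.extension_property j hj E.subtype
  have hh' : ∀ e : E, h (C.mkQ e) = e := fun e => LinearMap.congr_fun hh e
  have ess : ∀ z : J, z ∉ C → ∃ (r : R) (e : E), e ≠ 0 ∧ C.mkQ (r • z) = C.mkQ e := by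
    intro z hz
    by_contra hcon
    push Not at hcon
    have : C ⊔ Submodule.span R {z} ≤ C := by
      refine hC.le_of_ge ?_ le_sup_left
      intro x hx hxE
      obtain ⟨c, hc, y, hy, rfl⟩ := Submodule.mem_sup.mp hx
      obtain ⟨r, rfl⟩ := Submodule.mem_span_singleton.mp hy
      by_contra hne
      refine hcon r ⟨_, hxE⟩ (fun h0 => hne (congrArg Subtype.val h0)) ?_
      simp only [map_add]
      rw [(by simpa using hc : C.mkQ c = 0), zero_add]
    exact hz (this (Submodule.mem_sup_right (Submodule.mem_span_singleton_self z)))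
  have hrange : LinearMap.range h ≤ E := by
    refine hE.le_of_ge ⟨fun x hx => ⟨C.mkQ x, hh' ⟨x, hSE hx⟩⟩, ?_⟩ (fun x hx => ⟨C.mkQ x, hh' ⟨x, hx⟩⟩)
    rintro _ ⟨z, rfl⟩ hz
    obtain ⟨z, rfl⟩ := C.mkQ_surjective z
    have hzC : z ∉ C := fun hzC => hz (by rw [(by simpa using hzC : C.mkQ z = 0), map_zero])
    obtain ⟨r, e, he, hre⟩ := ess z hzC
    have h1 : r • h (C.mkQ z) = e := by rw [← map_smul, ← map_smul, hre, hh']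
    obtain ⟨t, ht, ht'⟩ := hEd.2 e e.2 (fun h0 => he (Subtype.ext h0))
    exact ⟨t * r, by rwa [mul_smul, h1], by rwa [mul_smul, h1]⟩
  let ρ : J →ₗ[R] E := LinearMap.codRestrict E (h.comp C.mkQ) (fun x => hrange ⟨_, rfl⟩)
  have hρ : ∀ e : E, ρ e = e := fun e => Subtype.ext (hh' e)
  refine ⟨E, hEd.1, hEd.2, ?_⟩
  intro I g
  obtain ⟨g', hg'⟩ := hJ I (E.subtype.comp g)
  exact ⟨ρ.comp g', fun x hx => by rw [LinearMap.comp_apply, hg' x hx]; exact hρ _⟩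

lemma exists_hull (R : Type u) [CommRing R] [IsLocalRing R] :
    ∃ E : ModuleCat.{u} R, Module.Baer R E ∧ ∃ e : E, e ≠ 0 ∧ (∀ x ∈ maximalIdeal R, x • e = 0) ∧
      ∀ z : E, (∀ x ∈ maximalIdeal R, x • z = 0) → ∃ r : R, z = r • e := by
  let k : ModuleCat.{u} R := ModuleCat.of R (R ⧸ maximalIdeal R)
  let ι := Injective.ι k
  have hι : Function.Injective ι.hom := (ModuleCat.mono_iff_injective ι).mp inferInstance
  have hJ := baer_of_injective_obj (Injective.under k)
  let e0 := ι.hom (Ideal.Quotient.mk _ (1 : R))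
  have he0 : e0 ≠ 0 := by
    intro h
    have := hι (h.trans (map_zero _).symm)
    exact (maximalIdeal.isMaximal R).ne_top
      ((Ideal.eq_top_iff_one _).mpr (Ideal.Quotient.eq_zero_iff_mem.mp this))
  have hm : ∀ x ∈ maximalIdeal R, x • e0 = 0 := by
    intro x hx
    have : x • (Ideal.Quotient.mk (maximalIdeal R) (1 : R)) = 0 := by
      rw [Algebra.smul_def, map_one, mul_one]
      exact Ideal.Quotient.eq_zero_iff_mem.mpr hx
    show x • ι.hom _ = 0
    rw [← map_smul]
    erw [this]
    exact map_zero _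
  obtain ⟨E, hE, hess, hb⟩ := exists_hull_aux hJ (Submodule.span R {e0})
  refine ⟨ModuleCat.of R E, hb, ⟨e0, hE (Submodule.mem_span_singleton_self _)⟩,
    fun h => he0 (congrArg Subtype.val h), fun x hx => Subtype.ext (hm x hx), ?_⟩
  rintro ⟨z, hz⟩ hmz
  by_cases hz0 : z = 0
  · exact ⟨0, Subtype.ext (by simpa using hz0)⟩
  obtain ⟨r, hr, hr'⟩ := hess z hz hz0
  have hru : IsUnit r := by
    by_contra hu
    exact hr (congrArg Subtype.val (hmz r hu))
  obtain ⟨t, ht⟩ := Submodule.mem_span_singleton.mp hr'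
  obtain ⟨a, ha⟩ := hru.exists_left_inv
  refine ⟨a * t, Subtype.ext ?_⟩
  show z = (a * t) • e0
  rw [mul_smul, ht, ← mul_smul, ha, one_smul]

end CofPf

set_option linter.unusedSectionVars false

namespace CofPf
open CategoryTheory Limits Pretriangulated Opposite

section tri
variable {C : Type u} [Category.{v} C] [Preadditive C] [HasZeroObject C] [HasShift C ℤ]
  [∀ n : ℤ, (shiftFunctor C n).Additive] [Pretriangulated C]

/-- the connecting map `X₃⟦j⟧ ⟶ X₁⟦j+1⟧` -/
noncomputable def dl {X Y : C} (h : X ⟶ Y⟦(1 : ℤ)⟧) (j j' : ℤ) (hj : 1 + j = j') :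
    X⟦j⟧ ⟶ Y⟦j'⟧ :=
  h⟦j⟧' ≫ (shiftFunctorAdd' C 1 j j' hj).inv.app Y

lemma dl_comp {X Y Z : C} (h : X ⟶ Y⟦(1 : ℤ)⟧) (g : Y ⟶ Z) (j j' : ℤ) (hj : 1 + j = j') :
    dl h j j' hj ≫ g⟦j'⟧' = dl (h ≫ g⟦(1:ℤ)⟧') j j' hj := by
  simp only [dl, Functor.map_comp, Category.assoc]
  congr 1
  exact ((shiftFunctorAdd' C 1 j j' hj).inv.naturality g).symm

lemma comp_dl {X Y Z : C} (h : X ⟶ Y⟦(1 : ℤ)⟧) (g : Z ⟶ X) (j j' : ℤ) (hj : 1 + j = j') :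
    g⟦j⟧' ≫ dl h j j' hj = dl (g ≫ h) j j' hj := by
  simp [dl]

lemma dl_zero {X Y : C} (j j' : ℤ) (hj : 1 + j = j') :
    dl (0 : X ⟶ Y⟦(1 : ℤ)⟧) j j' hj = 0 := by simp [dl]

lemma comp_dl_eq_zero {A X Y : C} (h : X ⟶ Y⟦(1 : ℤ)⟧) (j j' : ℤ) (hj : 1 + j = j')
    (f : A ⟶ X⟦j⟧) : f ≫ dl h j j' hj = 0 ↔ f ≫ h⟦j⟧' = 0 := by
  rw [dl, ← Category.assoc]
  exact ⟨fun H => by rwa [← cancel_mono ((shiftFunctorAdd' C 1 j j' hj).inv.app Y), zero_comp],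
    fun H => by rw [H, zero_comp]⟩

lemma hex2 {T : Triangle C} (hT : T ∈ distTriang C) (j : ℤ) {A : C} (f : A ⟶ T.obj₂⟦j⟧)
    (hf : f ≫ T.mor₂⟦j⟧' = 0) : ∃ g : A ⟶ T.obj₁⟦j⟧, g ≫ T.mor₁⟦j⟧' = f := by
  have hT' := Triangle.shift_distinguished T hT j
  have h0 : f ≫ (j.negOnePow • T.mor₂⟦j⟧') = 0 := by
    rw [Linear.comp_units_smul, hf, smul_zero]
  obtain ⟨g, hg⟩ : ∃ g : A ⟶ T.obj₁⟦j⟧, f = g ≫ (j.negOnePow • T.mor₁⟦j⟧') :=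
    Triangle.coyoneda_exact₂ _ hT' f h0
  refine ⟨j.negOnePow • g, ?_⟩
  rw [hg]
  rw [Linear.comp_units_smul, Linear.units_smul_comp]

lemma hex3 {T : Triangle C} (hT : T ∈ distTriang C) (j j' : ℤ) (hj : 1 + j = j') {A : C}
    (f : A ⟶ T.obj₃⟦j⟧) (hf : f ≫ dl T.mor₃ j j' hj = 0) :
    ∃ g : A ⟶ T.obj₂⟦j⟧, g ≫ T.mor₂⟦j⟧' = f :=
  hex2 (rot_of_distTriang _ hT) j f ((comp_dl_eq_zero _ _ _ _ _).mp hf)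

lemma hex1 {T : Triangle C} (hT : T ∈ distTriang C) (j j' : ℤ) (hj : 1 + j = j') {A : C}
    (f : A ⟶ T.obj₁⟦j'⟧) (hf : f ≫ T.mor₁⟦j'⟧' = 0) :
    ∃ g : A ⟶ T.obj₃⟦j⟧, g ≫ dl T.mor₃ j j' hj = f := by
  have h0 : (f ≫ (shiftFunctorAdd' C 1 j j' hj).hom.app T.obj₁) ≫ (-T.mor₁⟦(1:ℤ)⟧')⟦j⟧' = 0 := by
    rw [Functor.map_neg, Preadditive.comp_neg, Category.assoc]
    have := (shiftFunctorAdd' C 1 j j' hj).hom.naturality T.mor₁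
    simp only [Functor.comp_map] at this
    rw [← this, ← Category.assoc, hf, zero_comp, neg_zero]
  obtain ⟨g, hg⟩ : ∃ g : A ⟶ T.obj₃⟦j⟧, g ≫ T.mor₃⟦j⟧' =
      f ≫ (shiftFunctorAdd' C 1 j j' hj).hom.app T.obj₁ :=
    hex2 (rot_of_distTriang _ (rot_of_distTriang _ hT)) j _ h0
  refine ⟨g, ?_⟩
  rw [dl, ← Category.assoc, hg, Category.assoc, Iso.hom_inv_id_app, Category.comp_id]

lemma hz12 {T : Triangle C} (hT : T ∈ distTriang C) (j : ℤ) : T.mor₁⟦j⟧' ≫ T.mor₂⟦j⟧' = 0 := by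
  rw [← Functor.map_comp, comp_distTriang_mor_zero₁₂ _ hT, Functor.map_zero]

lemma hz23 {T : Triangle C} (hT : T ∈ distTriang C) (j j' : ℤ) (hj : 1 + j = j') :
    T.mor₂⟦j⟧' ≫ dl T.mor₃ j j' hj = 0 := by
  rw [comp_dl, comp_distTriang_mor_zero₂₃ _ hT, dl_zero]

lemma hz31 {T : Triangle C} (hT : T ∈ distTriang C) (j j' : ℤ) (hj : 1 + j = j') :
    dl T.mor₃ j j' hj ≫ T.mor₁⟦j'⟧' = 0 := by
  rw [dl_comp, comp_distTriang_mor_zero₃₁ _ hT, dl_zero]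

end tri

section Gm
variable (R : Type w) [CommRing R] {C : Type u} [Category.{v} C] [Preadditive C] [Linear R C]

/-- filtered colimit of `Hom(A n, X)` -/
def Gm (A : ℕᵒᵖ ⥤ C) (X : C) : Type _ :=
  Module.DirectLimit (R := R) (ι := ℕ) (fun n => (A.obj (op n) ⟶ X))
    (fun _ _ h => Linear.leftComp R X (A.map (homOfLE h).op))

variable (A : ℕᵒᵖ ⥤ C)

noncomputable instance (X : C) : AddCommGroup (Gm R A X) := by unfold Gm; infer_instance
noncomputable instance (X : C) : Module R (Gm R A X) := by unfold Gm; infer_instance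

/-- structure map -/
noncomputable def Gmk (n : ℕ) {X : C} : (A.obj (op n) ⟶ X) →ₗ[R] Gm R A X :=
  Module.DirectLimit.of R ℕ _ (fun _ _ h => Linear.leftComp R X (A.map (homOfLE h).op)) n

variable {X Y Z : C}
lemma Gmk_map {n k : ℕ} (h : n ≤ k) (f : A.obj (op n) ⟶ X) :
    Gmk R A k (A.map (homOfLE h).op ≫ f) = Gmk R A n f :=
  Module.DirectLimit.of_f (f := (fun _ _ h => Linear.leftComp R X (A.map (homOfLE h).op)))

lemma Gm_exists (g : Gm R A X) : ∃ n f, Gmk R A n f = g := Module.DirectLimit.exists_of _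

lemma Gmk_eq_zero {n : ℕ} (f : A.obj (op n) ⟶ X) (h : Gmk R A n f = 0) :
    ∃ k, ∃ h : n ≤ k, A.map (homOfLE h).op ≫ f = 0 := by
  have : DirectedSystem (fun n => (A.obj (op n) ⟶ X))
      (fun _ _ h => Linear.leftComp R X (A.map (homOfLE h).op)) :=
    { map_self := fun i x => by
        show A.map _ ≫ x = x
        have : (homOfLE (le_refl i)).op = 𝟙 (op i) := Subsingleton.elim _ _
        rw [this, A.map_id, Category.id_comp]
      map_map := fun k j i hij hjk x => by
        show A.map _ ≫ A.map _ ≫ x = A.map _ ≫ x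
        rw [← Category.assoc, ← A.map_comp]
        rfl }
  obtain ⟨k, hk, h⟩ := Module.DirectLimit.of.zero_exact h
  exact ⟨k, hk, h⟩

/-- functoriality -/
noncomputable def Gmap (φ : X ⟶ Y) : Gm R A X →ₗ[R] Gm R A Y :=
  Module.DirectLimit.map (fun n => Linear.rightComp R (A.obj (op n)) φ)
    (fun i j h => by ext f; simp)

@[simp] lemma Gmap_mk (φ : X ⟶ Y) (n : ℕ) (f : A.obj (op n) ⟶ X) :
    Gmap R A φ (Gmk R A n f) = Gmk R A n (f ≫ φ) :=
  Module.DirectLimit.map_apply_of _ _ _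

lemma Gmap_comp (φ : X ⟶ Y) (ψ : Y ⟶ Z) (g : Gm R A X) :
    Gmap R A (φ ≫ ψ) g = Gmap R A ψ (Gmap R A φ g) := by
  obtain ⟨n, f, rfl⟩ := Gm_exists R A g
  simp

lemma Gmap_id (g : Gm R A X) : Gmap R A (𝟙 X) g = g := by
  obtain ⟨n, f, rfl⟩ := Gm_exists R A g
  simp

lemma Gmap_zero (g : Gm R A X) : Gmap R A (0 : X ⟶ Y) g = 0 := by
  obtain ⟨n, f, rfl⟩ := Gm_exists R A g
  simp

lemma Gmap_smul (r : R) (φ : X ⟶ Y) (g : Gm R A X) : Gmap R A (r • φ) g = r • Gmap R A φ g := by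
  obtain ⟨n, f, rfl⟩ := Gm_exists R A g
  simp

lemma Gmap_add (φ ψ : X ⟶ Y) (g : Gm R A X) :
    Gmap R A (φ + ψ) g = Gmap R A φ g + Gmap R A ψ g := by
  obtain ⟨n, f, rfl⟩ := Gm_exists R A g
  simp

/-- an iso induces a linear equivalence -/
noncomputable def Gequiv (e : X ≅ Y) : Gm R A X ≃ₗ[R] Gm R A Y :=
  LinearEquiv.ofLinear (Gmap R A e.hom) (Gmap R A e.inv)
    (by ext g; simp [← Gmap_comp, Gmap_id]) (by ext g; simp [← Gmap_comp, Gmap_id])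

/-- exactness transfer -/
lemma Gm_exact (φ : X ⟶ Y) (ψ : Y ⟶ Z)
    (h : ∀ (B : C) (f : B ⟶ Y), f ≫ ψ = 0 → ∃ g : B ⟶ X, g ≫ φ = f) (y : Gm R A Y)
    (hy : Gmap R A ψ y = 0) : ∃ x, Gmap R A φ x = y := by
  obtain ⟨n, f, rfl⟩ := Gm_exists R A y
  rw [Gmap_mk] at hy
  obtain ⟨k, hk, h0⟩ := Gmk_eq_zero R A _ hy
  obtain ⟨g, hg⟩ := h _ (A.map (homOfLE hk).op ≫ f) (by rw [Category.assoc, h0])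
  exact ⟨Gmk R A k g, by rw [Gmap_mk, hg, Gmk_map]⟩

lemma Gm_subsingleton (h : ∀ n (f : A.obj (op n) ⟶ X), ∃ k, ∃ h : n ≤ k,
    A.map (homOfLE h).op ≫ f = 0) : Subsingleton (Gm R A X) := by
  refine subsingleton_of_forall_eq 0 fun g => ?_
  obtain ⟨n, f, rfl⟩ := Gm_exists R A g
  obtain ⟨k, hk, h0⟩ := h n f
  rw [← Gmk_map R A hk, h0, map_zero]

end Gm
end CofPf

set_option linter.unusedSectionVars false

namespace CofPf
open CategoryTheory Limits Pretriangulated Opposite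

section
variable {C : Type u} [Category.{v} C] [Preadditive C] [HasZeroObject C] [HasShift C ℤ]
  [∀ n : ℤ, (shiftFunctor C n).Additive] [Pretriangulated C]

lemma delta_factor {T : Triangle C} (hT : T ∈ distTriang C) {X : C} (j j' : ℤ) (hj : j + 1 = j')
    (f : T.obj₃ ⟶ X⟦j'⟧) (hf : T.mor₂ ≫ f = 0) :
    ∃ g : T.obj₁ ⟶ X⟦j⟧, f = T.mor₃ ≫ g⟦(1:ℤ)⟧' ≫ (shiftFunctorAdd' C j 1 j' hj).inv.app X := by
  obtain ⟨h, hh⟩ := Triangle.yoneda_exact₃ T hT f hf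
  obtain ⟨g, hg⟩ := (shiftFunctor C (1:ℤ)).map_surjective
    (h ≫ (shiftFunctorAdd' C j 1 j' hj).hom.app X)
  refine ⟨g, ?_⟩
  have hg' : g⟦(1:ℤ)⟧' = h ≫ (shiftFunctorAdd' C j 1 j' hj).hom.app X := hg
  rw [hh, hg', Category.assoc, Iso.hom_inv_id_app, Category.comp_id]
end

noncomputable instance instHDC (R : Type u) [CommRing R] :
    HasDerivedCategory.{u+1} (ModuleCat.{u} R) := HasDerivedCategory.standard _

/-- the derived category -/
abbrev Dc (R : Type u) [CommRing R] := DerivedCategory (ModuleCat.{u} R)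

/-- the embedding of modules -/
noncomputable abbrev Sg (R : Type u) [CommRing R] : ModuleCat.{u} R ⥤ Dc R :=
  DerivedCategory.singleFunctor (ModuleCat.{u} R) 0

variable {R : Type u} [CommRing R]

lemma hom_neg (A N : ModuleCat.{u} R) (j : ℤ) (hj : j < 0) (f : (Sg R).obj A ⟶ ((Sg R).obj N)⟦j⟧) :
    f = 0 := by
  have h1 : ((Sg R).obj N)⟦j⟧.IsGE (-j) :=
    DerivedCategory.TStructure.t.isGE_shift _ 0 j (-j) (by omega)
  exact DerivedCategory.TStructure.t.zero f 0 (-j) (by omega)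

lemma hom_proj (A N : ModuleCat.{u} R) [Projective A] (j : ℤ) (hj : 0 < j)
    (f : (Sg R).obj A ⟶ ((Sg R).obj N)⟦j⟧) : f = 0 := by
  obtain ⟨n, rfl⟩ : ∃ n : ℕ, j = ((n + 1 : ℕ) : ℤ) := ⟨j.toNat - 1, by omega⟩
  have := Abelian.Ext.eq_zero_of_projective ((Abelian.Ext.homEquiv (n := n+1)).symm f)
  have h2 := congrArg Abelian.Ext.hom this
  simpa using h2

lemma hom_inj (A N : ModuleCat.{u} R) [Injective N] (j : ℤ) (hj : 0 < j)
    (f : (Sg R).obj A ⟶ ((Sg R).obj N)⟦j⟧) : f = 0 := by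
  obtain ⟨n, rfl⟩ : ∃ n : ℕ, j = ((n + 1 : ℕ) : ℤ) := ⟨j.toNat - 1, by omega⟩
  have := Abelian.Ext.eq_zero_of_injective ((Abelian.Ext.homEquiv (n := n+1)).symm f)
  have h2 := congrArg Abelian.Ext.hom this
  simpa using h2

lemma hom_fin [IsNoetherianRing R] (A N : ModuleCat.{u} R) [Module.Finite R A] [Module.Finite R N] (j : ℤ) :
    Module.Finite R ((Sg R).obj A ⟶ ((Sg R).obj N)⟦j⟧) := by
  rcases lt_or_ge j 0 with hj | hj
  · have : Subsingleton ((Sg R).obj A ⟶ ((Sg R).obj N)⟦j⟧) :=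
      subsingleton_of_forall_eq 0 (hom_neg A N j hj)
    infer_instance
  · obtain ⟨n, rfl⟩ := Int.eq_ofNat_of_zero_le hj
    have := ModuleCat.finite_ext R A N n
    exact Module.Finite.equiv (Abelian.Ext.homLinearEquiv (R := R) (X := A) (Y := N) (n := n))

lemma hom_zero_surj (A N : ModuleCat.{u} R) (f : (Sg R).obj A ⟶ ((Sg R).obj N)⟦(0:ℤ)⟧) :
    ∃ φ : A ⟶ N, f = (Sg R).map φ ≫ (shiftFunctorZero (Dc R) ℤ).inv.app ((Sg R).obj N) := by
  obtain ⟨φ, hφ⟩ := (Sg R).map_surjective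
    (f ≫ (shiftFunctorZero (Dc R) ℤ).hom.app ((Sg R).obj N))
  refine ⟨φ, ?_⟩
  rw [hφ]
  clear hφ
  generalize (Sg R).obj N = X at f
  simp

lemma hom_zero_inj (A N : ModuleCat.{u} R) (φ : A ⟶ N)
    (h : (Sg R).map φ ≫ (shiftFunctorZero (Dc R) ℤ).inv.app ((Sg R).obj N) = 0) : φ = 0 := by
  apply (Sg R).map_injective
  rw [← cancel_mono ((shiftFunctorZero (Dc R) ℤ).inv.app ((Sg R).obj N)), h]
  simp

end CofPf

set_option linter.unusedSectionVars false

namespace CofPf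
open CategoryTheory Limits Pretriangulated Opposite IsLocalRing

variable {R : Type u} [CommRing R]

lemma ses_tri {S : ShortComplex (ModuleCat.{u} R)} (hS : S.ShortExact) :
    ∃ δ : (Sg R).obj S.X₃ ⟶ ((Sg R).obj S.X₁)⟦(1:ℤ)⟧,
      Triangle.mk ((Sg R).map S.f) ((Sg R).map S.g) δ ∈ distTriang (Dc R) :=
  ⟨hS.singleδ, hS.singleTriangle_distinguished⟩

lemma ses_factor {S : ShortComplex (ModuleCat.{u} R)} (hS : S.ShortExact) {X : Dc R}
    (j j' : ℤ) (hj : j + 1 = j') (f : (Sg R).obj S.X₃ ⟶ X⟦j'⟧) (hf : (Sg R).map S.g ≫ f = 0) :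
    ∃ g : (Sg R).obj S.X₁ ⟶ X⟦j⟧, ∀ (S' : ShortComplex (ModuleCat.{u} R)) (_ : S'.ShortExact)
      (φ : S' ⟶ S), (Sg R).map φ.τ₁ ≫ g = 0 → (Sg R).map φ.τ₃ ≫ f = 0 := by
  obtain ⟨g, hg⟩ : ∃ g : (Sg R).obj S.X₁ ⟶ X⟦j⟧, f = hS.singleδ ≫ g⟦(1:ℤ)⟧' ≫
      (shiftFunctorAdd' (Dc R) j 1 j' hj).inv.app X :=
    delta_factor hS.singleTriangle_distinguished j j' hj f hf
  refine ⟨g, fun S' hS' φ h => ?_⟩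
  have hc : hS'.singleδ ≫ ((Sg R).map φ.τ₁)⟦(1:ℤ)⟧' = (Sg R).map φ.τ₃ ≫ hS.singleδ :=
    (ShortComplex.ShortExact.singleTriangle.map hS' hS φ).comm₃
  rw [hg, ← Category.assoc, ← hc, Category.assoc, ← Category.assoc (((Sg R).map φ.τ₁)⟦(1:ℤ)⟧'),
    ← Functor.map_comp, h, Functor.map_zero, zero_comp, comp_zero]

/-- `I`-torsion modules -/
def Tor (I : Ideal R) (N : Type v) [AddCommGroup N] [Module R N] : Prop :=
  ∀ x : N, ∃ n : ℕ, ∀ a ∈ I ^ n, a • x = 0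

lemma tor_map {I : Ideal R} {N : Type v} [AddCommGroup N] [Module R N] (hN : Tor I N)
    {U : Type w} [AddCommGroup U] [Module R U] [Module.Finite R U] (φ : U →ₗ[R] N) :
    ∃ n : ℕ, ∀ x ∈ (I ^ n • ⊤ : Submodule R U), φ x = 0 := by
  obtain ⟨s, hs⟩ := (Module.Finite.fg_top : (⊤ : Submodule R U).FG)
  choose n hn using fun x : U => hN (φ x)
  refine ⟨s.sup n, fun x hx => ?_⟩
  have hle : ∀ y, ∀ a ∈ I ^ (s.sup n), a • φ y = 0 := by
    intro y a ha
    have hy : y ∈ Submodule.span R (s : Set U) := hs ▸ Submodule.mem_top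
    induction hy using Submodule.span_induction with
    | mem y hy => exact hn y a (Ideal.pow_le_pow_right (Finset.le_sup hy) ha)
    | zero => simp
    | add y z _ _ h1 h2 => rw [map_add, smul_add, h1, h2, add_zero]
    | smul r y _ h => rw [map_smul, smul_comm, h, smul_zero]
  refine Submodule.smul_induction_on hx (fun a ha y _ => ?_) (fun y z hy hz => ?_)
  · rw [map_smul, hle y a ha]
  · rw [map_add, hy, hz, add_zero]

lemma ar_aux [IsNoetherianRing R] (I : Ideal R) (N : ModuleCat.{u} R) (hN : Tor I N) (j : ℕ) :
    ∀ (U : ModuleCat.{u} R) [Module.Finite R U] (f : (Sg R).obj U ⟶ ((Sg R).obj N)⟦(j:ℤ)⟧),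
    ∃ n : ℕ, (Sg R).map (ModuleCat.ofHom (I ^ n • ⊤ : Submodule R U).subtype) ≫ f = 0 := by
  induction j with
  | zero =>
    intro U _ f
    obtain ⟨φ, rfl⟩ := hom_zero_surj U N f
    obtain ⟨n, hn⟩ := tor_map hN φ.hom
    refine ⟨n, ?_⟩
    rw [← Category.assoc, ← Functor.map_comp]
    have : (ModuleCat.ofHom (I ^ n • ⊤ : Submodule R U).subtype) ≫ φ = 0 := by
      ext x
      exact hn x.1 x.2
    rw [this, Functor.map_zero, zero_comp]
  | succ j ih =>
    intro U _ f
    obtain ⟨F, _, _, _, _, π, hπ⟩ := Module.exists_finite_presentation R U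
    have hS := LinearMap.shortExact_shortComplexKer hπ
    have hpr : Projective (ModuleCat.of R F) := inferInstance
    obtain ⟨g, hg⟩ := ses_factor hS (X := (Sg R).obj N) j (j+1:ℕ) (by push_cast; rfl) f
      (hom_proj (ModuleCat.of R F) N _ (by positivity) _)
    obtain ⟨n0, hn0⟩ := ih (ModuleCat.of R (LinearMap.ker π)) g
    obtain ⟨k, hk⟩ := Ideal.exists_pow_inf_eq_pow_smul I (LinearMap.ker π)
    have hAR : ∀ x : LinearMap.ker π, (x : F) ∈ (I ^ (k + n0) • ⊤ : Submodule R F) →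
        x ∈ (I ^ n0 • ⊤ : Submodule R (LinearMap.ker π)) := by
      intro x hx
      have h1 : (x : F) ∈ I ^ (k + n0) • ⊤ ⊓ LinearMap.ker π := ⟨hx, x.2⟩
      rw [hk _ (Nat.le_add_right _ _), Nat.add_sub_cancel_left] at h1
      have h2 : (x : F) ∈ I ^ n0 • LinearMap.ker π := Submodule.smul_mono le_rfl inf_le_right h1
      have h3 : (I ^ n0 • ⊤ : Submodule R (LinearMap.ker π)).map (LinearMap.ker π).subtype =
        I ^ n0 • LinearMap.ker π := by simp [Submodule.map_smul'']
      rw [← h3] at h2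
      obtain ⟨y, hy, hyx⟩ := h2
      rwa [← Subtype.ext hyx]
    let F' : Submodule R F := I ^ (k + n0) • ⊤
    let U' : Submodule R U := I ^ (k + n0) • ⊤
    have hFU : F'.map π = U' := by
      simp only [F', U', Submodule.map_smul'', Submodule.map_top, LinearMap.range_eq_top.mpr hπ]
    let π' : F' →ₗ[R] U' := π.restrict (fun x hx => hFU ▸ Submodule.mem_map_of_mem hx)
    have hπ' : Function.Surjective π' := by
      rintro ⟨y, hy⟩
      obtain ⟨x, hx, rfl⟩ := hFU.symm ▸ hy
      exact ⟨⟨x, hx⟩, rfl⟩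
    let τ : LinearMap.ker π' →ₗ[R] LinearMap.ker π :=
      (F'.subtype.comp (LinearMap.ker π').subtype).codRestrict _ (by
        intro x
        exact congrArg Subtype.val x.2)
    let τ' : LinearMap.ker π' →ₗ[R] (I ^ n0 • ⊤ : Submodule R (LinearMap.ker π)) :=
      τ.codRestrict _ (fun x => hAR _ x.1.2)
    let φ : π'.shortComplexKer ⟶ π.shortComplexKer :=
      { τ₁ := ModuleCat.ofHom τ
        τ₂ := ModuleCat.ofHom F'.subtype
        τ₃ := ModuleCat.ofHom U'.subtype
        comm₁₂ := rfl
        comm₂₃ := rfl }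
    refine ⟨k + n0, hg _ (LinearMap.shortExact_shortComplexKer hπ') φ ?_⟩
    have h5 : φ.τ₁ = ModuleCat.ofHom τ' ≫ ModuleCat.ofHom
      (I ^ n0 • ⊤ : Submodule R (LinearMap.ker π)).subtype := rfl
    rw [h5, Functor.map_comp, Category.assoc]
    exact (congrArg _ hn0).trans comp_zero

/-- tower `S(R/I^n)` -/
noncomputable abbrev Tw (I : Ideal R) : ℕᵒᵖ ⥤ Dc R :=
  localCohomology.ringModIdeals (localCohomology.idealPowersDiagram I) ⋙ Sg R

/-- the short complex of a pair of maps -/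
abbrev scM {A B C : Type u} [AddCommGroup A] [AddCommGroup B] [AddCommGroup C] [Module R A]
    [Module R B] [Module R C] (f : A →ₗ[R] B) (g : B →ₗ[R] C) (h : ∀ x, g (f x) = 0) :
    ShortComplex (ModuleCat.{u} R) where
  X₁ := ModuleCat.of R A
  X₂ := ModuleCat.of R B
  X₃ := ModuleCat.of R C
  f := ModuleCat.ofHom f
  g := ModuleCat.ofHom g
  zero := by ext x; exact h x

lemma scM_exact {A B C : Type u} [AddCommGroup A] [AddCommGroup B] [AddCommGroup C] [Module R A]
    [Module R B] [Module R C] (f : A →ₗ[R] B) (g : B →ₗ[R] C) (h : ∀ x, g (f x) = 0)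
    (hf : Function.Injective f) (hg : Function.Surjective g)
    (hfg : ∀ y, g y = 0 → ∃ x, f x = y) : (scM f g h).ShortExact where
  exact := (ShortComplex.ShortExact.moduleCat_exact_iff_function_exact _).mpr
    (fun y => ⟨hfg y, by rintro ⟨x, rfl⟩; exact h x⟩)
  mono_f := (ModuleCat.mono_iff_injective _).mpr hf
  epi_g := (ModuleCat.epi_iff_surjective _).mpr hg

/-- sub/quotient sequence -/
abbrev scQ {B : Type u} [AddCommGroup B] [Module R B] (U : Submodule R B) :
    ShortComplex (ModuleCat.{u} R) :=
  scM U.subtype U.mkQ (fun x => by simp)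

lemma scQ_exact {B : Type u} [AddCommGroup B] [Module R B] (U : Submodule R B) :
    (scQ U).ShortExact :=
  scM_exact _ _ _ U.injective_subtype U.mkQ_surjective (fun y hy => ⟨⟨y, by simpa using hy⟩, rfl⟩)

lemma Gm_torsion [IsNoetherianRing R] (I : Ideal R) (N : ModuleCat.{u} R) (hN : Tor I N)
    (j : ℤ) (hj : 0 < j) : Subsingleton (Gm R (Tw I) (((Sg R).obj N)⟦j⟧)) := by
  obtain ⟨i, rfl⟩ : ∃ i : ℕ, j = ((i + 1 : ℕ) : ℤ) := ⟨j.toNat - 1, by omega⟩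
  refine Gm_subsingleton R _ fun n f => ?_
  obtain ⟨g, hg⟩ := ses_factor (scQ_exact (I ^ n)) (X := (Sg R).obj N) i (i+1:ℕ)
      (by push_cast; rfl) f
      (hom_proj (ModuleCat.of R R) N _ (by positivity) _)
  obtain ⟨m, hm⟩ := ar_aux I N hN i (ModuleCat.of R (I ^ n : Ideal R)) g
  have hle : I ^ (n + m) ≤ I ^ n := Ideal.pow_le_pow_right (Nat.le_add_right _ _)
  have hAR : ∀ x : R, (hx : x ∈ I ^ (n + m)) →
      (⟨x, hle hx⟩ : (I ^ n : Ideal R)) ∈ (I ^ m • ⊤ : Submodule R (I ^ n : Ideal R)) := by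
    intro x hx
    have h3 : (I ^ m • ⊤ : Submodule R (I ^ n : Ideal R)).map (I ^ n : Ideal R).subtype =
        I ^ (n + m) := by
      rw [Submodule.map_smul'', Submodule.map_top, Submodule.range_subtype, pow_add, mul_comm]; rfl
    have hx' := hx
    rw [← h3] at hx'
    obtain ⟨y, hy, hyx⟩ := hx'
    have : y = ⟨x, hle hx⟩ := Subtype.ext hyx
    rwa [← this]
  let τ' : (I ^ (n + m) : Ideal R) →ₗ[R] (I ^ m • ⊤ : Submodule R (I ^ n : Ideal R)) :=
    (Submodule.inclusion hle).codRestrict _ (fun x => hAR x.1 x.2)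
  let φ : scQ (I ^ (n + m)) ⟶ scQ (I ^ n) :=
    { τ₁ := ModuleCat.ofHom (Submodule.inclusion hle)
      τ₂ := 𝟙 _
      τ₃ := ModuleCat.ofHom (Submodule.mapQ _ _ LinearMap.id hle)
      comm₁₂ := rfl
      comm₂₃ := rfl }
  refine ⟨n + m, Nat.le_add_right _ _, hg _ (scQ_exact _) φ ?_⟩
  have h5 : φ.τ₁ = ModuleCat.ofHom τ' ≫ ModuleCat.ofHom
      (I ^ m • ⊤ : Submodule R (I ^ n : Ideal R)).subtype := rfl
  rw [h5, Functor.map_comp, Category.assoc]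
  exact (congrArg _ hm).trans comp_zero

lemma Gm_neg (I : Ideal R) (N : ModuleCat.{u} R)
    (j : ℤ) (hj : j < 0) : Subsingleton (Gm R (Tw I) (((Sg R).obj N)⟦j⟧)) :=
  Gm_subsingleton R _ fun n f => ⟨n, le_rfl, by
    have : f = 0 := hom_neg _ _ j hj f
    rw [this, comp_zero]⟩

lemma Gm_inj (I : Ideal R) (N : ModuleCat.{u} R) [Injective N]
    (j : ℤ) (hj : 0 < j) : Subsingleton (Gm R (Tw I) (((Sg R).obj N)⟦j⟧)) :=
  Gm_subsingleton R _ fun n f => ⟨n, le_rfl, by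
    have : f = 0 := hom_inj _ _ j hj f
    rw [this, comp_zero]⟩

end CofPf

set_option linter.unusedSectionVars false

namespace CofPf
open CategoryTheory Limits Pretriangulated Opposite IsLocalRing

variable {R : Type u} [CommRing R]

lemma hom_zero_linv (A N : ModuleCat.{u} R) (φ : A ⟶ N) :
    ((Sg R).map φ ≫ (shiftFunctorZero (Dc R) ℤ).inv.app ((Sg R).obj N)) ≫
      (shiftFunctorZero (Dc R) ℤ).hom.app ((Sg R).obj N) = (Sg R).map φ := by
  generalize (Sg R).map φ = f
  revert f
  generalize (Sg R).obj N = X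
  generalize (Sg R).obj A = Y
  intro f
  simp

/-- evaluation -/
noncomputable def ev0 (A N : ModuleCat.{u} R) :
    ((Sg R).obj A ⟶ ((Sg R).obj N)⟦(0:ℤ)⟧) →ₗ[R] (A →ₗ[R] N) where
  toFun f := ((Sg R).preimage (f ≫ (shiftFunctorZero (Dc R) ℤ).hom.app ((Sg R).obj N))).hom
  map_add' f g := by
    rw [← ModuleCat.hom_add]
    congr 1
    apply (Sg R).map_injective
    rw [Functor.map_add]
    simp only [Functor.map_preimage]
    exact Preadditive.add_comp _ _ _ f g _
  map_smul' r f := by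
    dsimp only [RingHom.id_apply]
    rw [← ModuleCat.hom_smul]
    congr 1
    apply (Sg R).map_injective
    rw [Functor.map_smul]
    simp only [Functor.map_preimage]
    exact Linear.smul_comp _ _ _ r f _

lemma ev0_apply (A N : ModuleCat.{u} R) (φ : A ⟶ N) :
    ev0 A N ((Sg R).map φ ≫ (shiftFunctorZero (Dc R) ℤ).inv.app ((Sg R).obj N)) = φ.hom := by
  show ModuleCat.Hom.hom ((Sg R).preimage _) = _
  congr 1
  apply (Sg R).map_injective
  rw [Functor.map_preimage, hom_zero_linv]

lemma ev0_inj (A N : ModuleCat.{u} R) : Function.Injective (ev0 A N) := by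
  rw [injective_iff_map_eq_zero]
  intro f hf
  obtain ⟨φ, rfl⟩ := hom_zero_surj A N f
  rw [ev0_apply] at hf
  have : φ = 0 := ModuleCat.hom_ext hf
  rw [this, Functor.map_zero, zero_comp]

lemma ev0_pre {A B N : ModuleCat.{u} R} (a : A ⟶ B) (f : (Sg R).obj B ⟶ ((Sg R).obj N)⟦(0:ℤ)⟧) :
    ev0 A N ((Sg R).map a ≫ f) = (ev0 B N f).comp a.hom := by
  obtain ⟨φ, rfl⟩ := hom_zero_surj B N f
  rw [ev0_apply, ← Category.assoc, ← Functor.map_comp, ev0_apply]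
  rfl

lemma ev0_post {A N N' : ModuleCat.{u} R} (f : (Sg R).obj A ⟶ ((Sg R).obj N)⟦(0:ℤ)⟧) (ψ : N ⟶ N') :
    ev0 A N' (f ≫ ((Sg R).map ψ)⟦(0:ℤ)⟧') = ψ.hom.comp (ev0 A N f) := by
  obtain ⟨φ, rfl⟩ := hom_zero_surj A N f
  rw [ev0_apply, Category.assoc]
  have : (shiftFunctorZero (Dc R) ℤ).inv.app ((Sg R).obj N) ≫ ((Sg R).map ψ)⟦(0:ℤ)⟧' =
    (Sg R).map ψ ≫ (shiftFunctorZero (Dc R) ℤ).inv.app ((Sg R).obj N') := by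
    exact ((shiftFunctorZero (Dc R) ℤ).inv.naturality ((Sg R).map ψ)).symm
  rw [this, ← Category.assoc, ← Functor.map_comp, ev0_apply]
  rfl

/-- the tower of modules -/
abbrev Ro (I : Ideal R) : ℕᵒᵖ ⥤ ModuleCat.{u} R :=
  localCohomology.ringModIdeals (localCohomology.idealPowersDiagram I)

/-- the generator -/
def one (I : Ideal R) (n : ℕ) : (Ro I).obj (op n) := (Ideal.Quotient.mk (I ^ n) 1 : R ⧸ I ^ n)

lemma one_gen (I : Ideal R) (n : ℕ) (x : (Ro I).obj (op n)) : ∃ r : R, x = r • one I n := by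
  obtain ⟨r, rfl⟩ := Ideal.Quotient.mk_surjective (I := I ^ n) x
  refine ⟨r, ?_⟩
  have : (Ideal.Quotient.mk (I ^ n) r) = r • (Ideal.Quotient.mk (I ^ n) 1) := by
    rw [Algebra.smul_def]; simp
  exact this

lemma one_kill (I : Ideal R) (n : ℕ) (a : R) (ha : a ∈ I ^ n) : a • one I n = 0 := by
  have : a • (Ideal.Quotient.mk (I ^ n) 1) = 0 := by
    rw [Algebra.smul_def]
    simpa using Ideal.Quotient.eq_zero_iff_mem.mpr ha
  exact this

lemma one_map (I : Ideal R) {i j : ℕ} (h : i ≤ j) :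
    ((Ro I).map (homOfLE h).op).hom (one I j) = one I i := rfl

/-- evaluation at `1` of the colimit -/
noncomputable def Gev (I : Ideal R) (N : ModuleCat.{u} R) :
    Gm R (Tw I) (((Sg R).obj N)⟦(0:ℤ)⟧) →ₗ[R] N :=
  Module.DirectLimit.lift R ℕ _ _ (fun n => (LinearMap.applyₗ (one I n)).comp
    (ev0 ((Ro I).obj (op n)) N)) (fun i j hij f => by
      have := ev0_pre ((Ro I).map (homOfLE hij).op) f
      exact LinearMap.congr_fun this (one I j))

lemma Gev_mk (I : Ideal R) (N : ModuleCat.{u} R) (n : ℕ)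
    (f : (Sg R).obj ((Ro I).obj (op n)) ⟶ ((Sg R).obj N)⟦(0:ℤ)⟧) :
    Gev I N (Gmk R (Tw I) n f) = ev0 ((Ro I).obj (op n)) N f (one I n) :=
  Module.DirectLimit.lift_of _ _ _

lemma Gev_inj (I : Ideal R) (N : ModuleCat.{u} R) : Function.Injective (Gev I N) := by
  rw [injective_iff_map_eq_zero]
  intro g hg
  obtain ⟨n, f, rfl⟩ := Gm_exists R _ g
  rw [Gev_mk] at hg
  have h2 : f = 0 := by
    apply ev0_inj ((Ro I).obj (op n)) N
    refine Eq.trans ?_ (map_zero _).symm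
    refine LinearMap.ext fun x => ?_
    obtain ⟨r, rfl⟩ := one_gen I n x
    rw [map_smul, hg, smul_zero]
    rfl
  rw [h2, map_zero]

lemma Gev_post (I : Ideal R) {N N' : ModuleCat.{u} R} (ψ : N ⟶ N')
    (g : Gm R (Tw I) (((Sg R).obj N)⟦(0:ℤ)⟧)) :
    Gev I N' (Gmap R (Tw I) (((Sg R).map ψ)⟦(0:ℤ)⟧') g) = ψ.hom (Gev I N g) := by
  obtain ⟨n, f, rfl⟩ := Gm_exists R _ g
  rw [Gmap_mk, Gev_mk, Gev_mk]
  exact LinearMap.congr_fun (ev0_post (A := (Ro I).obj (op n)) f ψ) (one I n)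

lemma Gev_tor (I : Ideal R) (N : ModuleCat.{u} R) (g) :
    ∃ n, ∀ a ∈ I ^ n, a • Gev I N g = 0 := by
  obtain ⟨n, f, rfl⟩ := Gm_exists R _ g
  refine ⟨n, fun a ha => ?_⟩
  rw [Gev_mk, ← map_smul, one_kill I n a ha, map_zero]

lemma Gev_surj (I : Ideal R) (N : ModuleCat.{u} R) (x : N) (n : ℕ) (hx : ∀ a ∈ I ^ n, a • x = 0) :
    ∃ g, Gev I N g = x := by
  let φ : (R ⧸ I ^ n) →ₗ[R] N := Submodule.liftQ (I ^ n) (LinearMap.toSpanSingleton R N x) (by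
    intro a ha
    rw [LinearMap.mem_ker, LinearMap.toSpanSingleton_apply]
    exact hx a ha)
  let ψ : (Ro I).obj (op n) ⟶ N := ModuleCat.ofHom φ
  refine ⟨Gmk R (Tw I) n ((Sg R).map ψ ≫
    (shiftFunctorZero (Dc R) ℤ).inv.app ((Sg R).obj N)), ?_⟩
  refine (Gev_mk I N n _).trans ?_
  refine (LinearMap.congr_fun (ev0_apply _ _ ψ) (one I n)).trans ?_
  show (LinearMap.toSpanSingleton R N x) 1 = x
  rw [LinearMap.toSpanSingleton_apply, one_smul]

/-- every element of `G` is torsion -/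
lemma Gm_tor (I : Ideal R) (X : Dc R) : Tor I (Gm R (Tw I) X) := by
  intro g
  obtain ⟨n, f, rfl⟩ := Gm_exists R _ g
  refine ⟨n, fun a ha => ?_⟩
  rw [← map_smul]
  have h0 : a • 𝟙 ((Ro I).obj (op n)) = 0 := by
    refine ModuleCat.hom_ext (LinearMap.ext fun x => ?_)
    obtain ⟨r, rfl⟩ := one_gen I n x
    show a • r • one I n = 0
    rw [smul_comm, one_kill I n a ha, smul_zero]
  have h1 : a • f = (Sg R).map (a • 𝟙 ((Ro I).obj (op n))) ≫ f := by
    rw [Functor.map_smul, CategoryTheory.Functor.map_id]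
    exact (congrArg (a • ·) (Category.id_comp f).symm).trans (Linear.smul_comp _ _ _ a _ f).symm
  have h2 : a • f = 0 := by
    refine h1.trans ?_
    rw [h0, Functor.map_zero, zero_comp]
  rw [h2, map_zero]

end CofPf

set_option linter.unusedSectionVars false

namespace CofPf
open CategoryTheory Limits Pretriangulated Opposite IsLocalRing

section gen
variable {R : Type u} [CommRing R]

lemma dev [IsNoetherianRing R] (Pr : ModuleCat.{u} R → Prop) (J : Ideal R)
    (hiso : ∀ {A B : ModuleCat.{u} R}, (A ≅ B) → Pr A → Pr B)
    (hext : ∀ S : ShortComplex (ModuleCat.{u} R), S.ShortExact → Pr S.X₁ → Pr S.X₃ → Pr S.X₂)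
    (hzero : ∀ A : ModuleCat.{u} R, Subsingleton A → Pr A)
    (hprime : ∀ P : Ideal R, P.IsPrime → J ≤ P → Pr (ModuleCat.of R (R ⧸ P)))
    (N : ModuleCat.{u} R) [Module.Finite R N] (hN : ∀ a ∈ J, ∀ x : N, a • x = 0) : Pr N := by
  have key : ∀ (N : Type u) [AddCommGroup N] [Module R N] [Module.Finite R N],
      (∀ a ∈ J, ∀ x : N, a • x = 0) → Pr (ModuleCat.of R N) := by
    intro N _ _ hf
    refine IsNoetherianRing.induction_on_isQuotientEquivQuotientPrime R
      (motive := fun N _ _ _ => (∀ a ∈ J, ∀ x : N, a • x = 0) → Pr (ModuleCat.of R N)) hf ?_ ?_ ?_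
    · intro N _ _ _ hs _
      exact hzero _ hs
    · intro N _ _ _ P e h
      refine hiso e.symm.toModuleIso (hprime P.1 P.2 fun a ha => ?_)
      have h1 := h a ha (e.symm (Ideal.Quotient.mk _ 1))
      rw [← map_smul, LinearEquiv.map_eq_zero_iff, Algebra.smul_def] at h1
      simpa [Ideal.Quotient.eq_zero_iff_mem] using h1
    · intro N₁ _ _ _ N₂ _ _ _ N₃ _ _ _ f g hf hg hfg h1 h3 h
      refine hext _ (scM_exact f g (fun x => (hfg _).mpr ⟨x, rfl⟩) hf hg
        (fun y hy => (hfg _).mp hy)) (h1 fun a ha x => hf ?_) (h3 fun a ha x => ?_)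
      · rw [map_smul, h a ha, map_zero]
      · obtain ⟨y, rfl⟩ := hg x
        rw [← map_smul, h a ha, map_zero]
  exact hiso (Iso.refl _) (key N hN)

lemma baer_exact {E : Type u} [AddCommGroup E] [Module R E] (hE : Module.Baer R E)
    {A B C : Type*} [AddCommGroup A] [AddCommGroup B] [AddCommGroup C] [Module R A]
    [Module R B] [Module R C] (f : A →ₗ[R] B) (g : B →ₗ[R] C) (hfg : ∀ b, g b = 0 → ∃ a, f a = b)
    (h : B →ₗ[R] E) (h0 : ∀ a, h (f a) = 0) : ∃ h' : C →ₗ[R] E, ∀ b, h' (g b) = h b := by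
  have hk : LinearMap.ker g ≤ LinearMap.ker h := by
    intro b hb
    obtain ⟨a, rfl⟩ := hfg b hb
    exact h0 a
  obtain ⟨h', hh'⟩ := hE.extension_property ((LinearMap.ker g).liftQ g le_rfl)
    (LinearMap.ker_eq_bot.mp (Submodule.ker_liftQ_eq_bot _ _ _ le_rfl))
    ((LinearMap.ker g).liftQ h hk)
  exact ⟨h', fun b => LinearMap.congr_fun hh' (Submodule.Quotient.mk b)⟩

lemma finite_mid [IsNoetherianRing R] {A B C : Type*} [AddCommGroup A] [AddCommGroup B]
    [AddCommGroup C] [Module R A] [Module R B] [Module R C] (hA : Module.Finite R A)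
    (hC : Module.Finite R C) (f : A →ₗ[R] B) (g : B →ₗ[R] C)
    (hfg : ∀ b, g b = 0 → ∃ a, f a = b) : Module.Finite R B := by
  constructor
  refine Submodule.fg_of_fg_map_of_fg_inf_ker g (IsNoetherian.noetherian _) ?_
  rw [top_inf_eq]
  have h1 : LinearMap.ker g ≤ LinearMap.range f := fun b hb => hfg b hb
  have h2 : IsNoetherian R (LinearMap.range f) := inferInstance
  have h3 : ((LinearMap.ker g).submoduleOf (LinearMap.range f)).FG := IsNoetherian.noetherian _
  have h4 := h3.map (LinearMap.range f).subtype
  rwa [Submodule.submoduleOf, Submodule.map_comap_eq_of_le (by simpa using h1)] at h4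

variable (R) [IsLocalRing R]
/-- the injective hull -/
noncomputable def EE : ModuleCat.{u} R := (exists_hull R).choose
lemma EE_baer : Module.Baer R (EE R) := (exists_hull R).choose_spec.1
lemma EE_soc : ∃ e : EE R, e ≠ 0 ∧ (∀ x ∈ maximalIdeal R, x • e = 0) ∧
      ∀ z : EE R, (∀ x ∈ maximalIdeal R, x • z = 0) → ∃ r : R, z = r • e :=
  (exists_hull R).choose_spec.2

variable {R}
lemma EE_cogen {V : Type v} [AddCommGroup V] [Module R V] (x : V) (hx : x ≠ 0) :
    ∃ f : V →ₗ[R] EE R, f x ≠ 0 := by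
  obtain ⟨e, he, hm, -⟩ := EE_soc R
  obtain ⟨f, hf⟩ := baer_exact (EE_baer R)
    (LinearMap.ker (LinearMap.toSpanSingleton R V x)).subtype
    (LinearMap.toSpanSingleton R V x) (fun b hb => ⟨⟨b, hb⟩, rfl⟩)
    (LinearMap.toSpanSingleton R (EE R) e) (by
      rintro ⟨r, hr⟩
      rw [LinearMap.mem_ker, LinearMap.toSpanSingleton_apply] at hr
      refine hm r ?_
      rw [mem_maximalIdeal, mem_nonunits_iff]
      intro hu
      exact hx ((hu.smul_eq_zero).mp hr))
  refine ⟨f, ?_⟩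
  have h1 := hf 1
  rw [LinearMap.toSpanSingleton_apply, LinearMap.toSpanSingleton_apply, one_smul, one_smul] at h1
  rwa [h1]

/-- local cohomology at the maximal ideal -/
abbrev GG (j : ℤ) (X : Dc R) := Gm R (Tw (maximalIdeal R)) (X⟦j⟧)
/-- its dual -/
abbrev VV (j : ℤ) (X : Dc R) := GG j X →ₗ[R] EE R

/-- functoriality -/
noncomputable abbrev Gp (j : ℤ) {X Y : Dc R} (φ : X ⟶ Y) : GG j X →ₗ[R] GG j Y :=
  Gmap R (Tw (maximalIdeal R)) (φ⟦j⟧')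
noncomputable abbrev Gd {X Y : Dc R} (h : X ⟶ Y⟦(1:ℤ)⟧) (j j' : ℤ) (hj : 1 + j = j') : GG j X →ₗ[R] GG j' Y :=
  Gmap R (Tw (maximalIdeal R)) (dl h j j' hj)
noncomputable def Vp (j : ℤ) {X Y : Dc R} (φ : X ⟶ Y) : VV j Y →ₗ[R] VV j X :=
  LinearMap.lcomp R (EE R) (Gp j φ)
/-- functoriality -/
noncomputable def Vd {X Y : Dc R} (h : X ⟶ Y⟦(1:ℤ)⟧) (j j' : ℤ) (hj : 1 + j = j') : VV j' Y →ₗ[R] VV j X :=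
  LinearMap.lcomp R (EE R) (Gd h j j' hj)

lemma Vp_apply (j : ℤ) {X Y : Dc R} (φ : X ⟶ Y) (v : VV j Y) (g : GG j X) :
  Vp j φ v g = v (Gp j φ g) := rfl

lemma Vp_comp (j : ℤ) {X Y Z : Dc R} (φ : X ⟶ Y) (ψ : Y ⟶ Z) (v : VV j Z) :
    Vp j (φ ≫ ψ) v = Vp j φ (Vp j ψ v) := by
  ext g
  simp only [Vp_apply, Gp]
  rw [Functor.map_comp, Gmap_comp]

lemma Vp_smul (j : ℤ) {X Y : Dc R} (r : R) (φ : X ⟶ Y) (v : VV j Y) :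
    Vp j (r • φ) v = r • (Vp j φ v) := by
  ext g
  show v (Gmap R _ _ g) = r • v _
  rw [Functor.map_smul, Gmap_smul, map_smul]

lemma Vp_id (j : ℤ) {X : Dc R} (v : VV j X) : Vp j (𝟙 X) v = v := by
  ext g
  show v (Gmap R _ _ g) = v _
  rw [CategoryTheory.Functor.map_id, Gmap_id]

/-- iso invariance -/
noncomputable def Vequiv (j : ℤ) {X Y : Dc R} (e : X ≅ Y) : VV j Y ≃ₗ[R] VV j X :=
  LinearEquiv.ofBijective (Vp j e.hom) ⟨fun a b h => by
    have := congrArg (Vp j e.inv) h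
    rwa [← Vp_comp, ← Vp_comp, e.inv_hom_id, Vp_id, Vp_id] at this,
    fun v => ⟨Vp j e.inv v, by rw [← Vp_comp, e.hom_inv_id, Vp_id]⟩⟩

lemma gex2 {T : Triangle (Dc R)} (hT : T ∈ distTriang (Dc R)) (j : ℤ) (y : GG j T.obj₂)
    (hy : Gp j T.mor₂ y = 0) : ∃ x, Gp j T.mor₁ x = y :=
  Gm_exact R _ _ _ (fun _ f hf => hex2 hT j f hf) y hy
lemma gex3 {T : Triangle (Dc R)} (hT : T ∈ distTriang (Dc R)) (j j' : ℤ) (hj : 1 + j = j')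
    (y : GG j T.obj₃) (hy : Gd T.mor₃ j j' hj y = 0) : ∃ x, Gp j T.mor₂ x = y :=
  Gm_exact R _ _ _ (fun _ f hf => hex3 hT j j' hj f hf) y hy
lemma gex1 {T : Triangle (Dc R)} (hT : T ∈ distTriang (Dc R)) (j j' : ℤ) (hj : 1 + j = j')
    (y : GG j' T.obj₁) (hy : Gp j' T.mor₁ y = 0) : ∃ x, Gd T.mor₃ j j' hj x = y :=
  Gm_exact R _ _ _ (fun _ f hf => hex1 hT j j' hj f hf) y hy

lemma vex2 {T : Triangle (Dc R)} (hT : T ∈ distTriang (Dc R)) (j : ℤ) (v : VV j T.obj₂)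
    (hv : Vp j T.mor₁ v = 0) : ∃ x, Vp j T.mor₂ x = v := by
  obtain ⟨w, hw⟩ := baer_exact (EE_baer R) (Gp j T.mor₁) (Gp j T.mor₂) (gex2 hT j) v
    (fun a => LinearMap.congr_fun hv a)
  exact ⟨w, LinearMap.ext hw⟩
lemma vex3 {T : Triangle (Dc R)} (hT : T ∈ distTriang (Dc R)) (j j' : ℤ) (hj : 1 + j = j')
    (v : VV j T.obj₃) (hv : Vp j T.mor₂ v = 0) : ∃ x, Vd T.mor₃ j j' hj x = v := by
  obtain ⟨w, hw⟩ := baer_exact (EE_baer R) (Gp j T.mor₂) (Gd T.mor₃ j j' hj) (gex3 hT j j' hj) v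
    (fun a => LinearMap.congr_fun hv a)
  exact ⟨w, LinearMap.ext hw⟩
lemma vex1 {T : Triangle (Dc R)} (hT : T ∈ distTriang (Dc R)) (j j' : ℤ) (hj : 1 + j = j')
    (v : VV j' T.obj₁) (hv : Vd T.mor₃ j j' hj v = 0) : ∃ x, Vp j' T.mor₁ x = v := by
  obtain ⟨w, hw⟩ := baer_exact (EE_baer R) (Gd T.mor₃ j j' hj) (Gp j' T.mor₁) (gex1 hT j j' hj) v
    (fun a => LinearMap.congr_fun hv a)
  exact ⟨w, LinearMap.ext hw⟩

lemma V_sep {y : R} (hy : y ∈ maximalIdeal R) (j : ℤ) (X : Dc R) (v : ℕ → VV j X)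
    (hv : ∀ n, v n = y • v (n + 1)) : v 0 = 0 := by
  have h1 : ∀ n, v 0 = y ^ n • v n := by
    intro n
    induction n with
    | zero => simp
    | succ n ih => rw [ih, hv n, smul_smul, pow_succ]
  ext g
  obtain ⟨n, hn⟩ := Gm_tor (maximalIdeal R) _ g
  rw [h1 n, LinearMap.smul_apply, ← map_smul, hn _ (Ideal.pow_mem_pow hy n), map_zero]
  rfl

lemma kill_GV {p : Ideal R} {j : ℤ} {X : Dc R} (h : Kill p (VV j X)) : Kill p (GG j X) := by
  obtain ⟨s, hs, h⟩ := h
  refine ⟨s, hs, fun g => ?_⟩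
  by_contra hne
  obtain ⟨f, hf⟩ := EE_cogen (R := R) _ hne
  apply hf
  rw [map_smul]
  exact LinearMap.congr_fun (h f) g

lemma kill_VG {p : Ideal R} {j : ℤ} {X : Dc R} (h : Kill p (GG j X)) : Kill p (VV j X) := by
  obtain ⟨s, hs, h⟩ := h
  refine ⟨s, hs, fun v => ?_⟩
  ext g
  show s • v g = 0
  rw [← map_smul, h, map_zero]

end gen
end CofPf

set_option linter.unusedSectionVars false

namespace CofPf
open CategoryTheory Limits Pretriangulated Opposite IsLocalRing

variable {R : Type u} [CommRing R] [IsLocalRing R]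

lemma Vp_zero (j : ℤ) {X Y : Dc R} (v : VV j Y) : Vp j (0 : X ⟶ Y) v = 0 := by
  have := Vp_smul j (0 : R) (0 : X ⟶ Y) v
  rwa [zero_smul, zero_smul] at this

lemma V_smul_of_kill (j : ℤ) {N : ModuleCat.{u} R} {s : R} (hs : ∀ x : N, s • x = 0)
    (v : VV j ((Sg R).obj N)) : s • v = 0 := by
  have h0 : s • 𝟙 N = 0 := ModuleCat.hom_ext (LinearMap.ext hs)
  have h1 : s • 𝟙 ((Sg R).obj N) = 0 := by
    rw [← CategoryTheory.Functor.map_id, ← Functor.map_smul, h0, Functor.map_zero]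
  rw [← Vp_id j v, ← Vp_smul, h1, Vp_zero]

lemma devV [IsNoetherianRing R] (K : (V : Type (u+1)) → [AddCommGroup V] → [Module R V] → Prop)
    (hmid : ∀ (A B C : Type (u+1)) [AddCommGroup A] [AddCommGroup B] [AddCommGroup C] [Module R A]
      [Module R B] [Module R C] (f : A →ₗ[R] B) (g : B →ₗ[R] C),
      (∀ b, g b = 0 → ∃ a, f a = b) → K A → K C → K B)
    (hz : ∀ (A : Type (u+1)) [AddCommGroup A] [Module R A] [Subsingleton A], K A)
    (j : ℤ) (J : Ideal R)
    (hprime : ∀ P : Ideal R, P.IsPrime → J ≤ P → K (VV j ((Sg R).obj (ModuleCat.of R (R ⧸ P)))))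
    (N : ModuleCat.{u} R) [Module.Finite R N] (hN : ∀ a ∈ J, ∀ x : N, a • x = 0) :
    K (VV j ((Sg R).obj N)) := by
  refine dev (fun N => K (VV j ((Sg R).obj N))) J ?_ ?_ ?_ hprime N hN
  · intro A B e h
    exact hmid _ _ PUnit (Vequiv j ((Sg R).mapIso e.symm)).toLinearMap 0
      (fun b _ => (Vequiv j ((Sg R).mapIso e.symm)).surjective b) h (hz _)
  · intro S hS h1 h3
    obtain ⟨δ, hT⟩ := ses_tri hS
    exact hmid _ _ _ (Vp j ((Sg R).map S.g)) (Vp j ((Sg R).map S.f)) (vex2 hT j) h3 h1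
  · intro A hA
    have : Subsingleton (VV j ((Sg R).obj A)) := subsingleton_of_forall_eq 0 fun v => by
      rw [← one_smul R v]
      exact V_smul_of_kill j (fun x => Subsingleton.elim _ _) v
    exact hz _

lemma prime_ind [IsNoetherianRing R] (Q : Ideal R → Prop)
    (h : ∀ P : Ideal R, P.IsPrime → (∀ P' : Ideal R, P'.IsPrime → P < P' → Q P') → Q P)
    (P : Ideal R) (hP : P.IsPrime) : Q P := by
  refine IsNoetherian.induction (R := R) (M := R) (P := fun J : Ideal R => J.IsPrime → Q J) ?_ P hP
  intro P ih hP
  exact h P hP fun P' hP' hlt => ih P' hlt hP'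

lemma mul_tri (P : Ideal R) (hP : P.IsPrime) (x : R) (hx : x ∉ P) :
    ∃ (π : ModuleCat.of R (R ⧸ P) ⟶ ModuleCat.of R (R ⧸ (P ⊔ Ideal.span {x})))
      (δ : (Sg R).obj (ModuleCat.of R (R ⧸ (P ⊔ Ideal.span {x}))) ⟶
      ((Sg R).obj (ModuleCat.of R (R ⧸ P)))⟦(1:ℤ)⟧),
      Triangle.mk (x • 𝟙 ((Sg R).obj (ModuleCat.of R (R ⧸ P))))
        ((Sg R).map π) δ ∈ distTriang (Dc R) := by
  have hle : P ≤ P ⊔ Ideal.span {x} := le_sup_left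
  let f : (R ⧸ P) →ₗ[R] (R ⧸ P) := x • LinearMap.id
  let g : (R ⧸ P) →ₗ[R] (R ⧸ (P ⊔ Ideal.span {x})) := Submodule.mapQ _ _ LinearMap.id hle
  have hS : (scM f g (by
      intro y
      obtain ⟨r, rfl⟩ := Ideal.Quotient.mk_surjective y
      show Ideal.Quotient.mk (P ⊔ Ideal.span {x}) (x * r) = 0
      rw [Ideal.Quotient.eq_zero_iff_mem]
      exact Ideal.mul_mem_right _ _ (le_sup_right (a := P) (Ideal.mem_span_singleton_self x)))).ShortExact := by
    refine scM_exact _ _ _ ?_ ?_ ?_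
    · rw [injective_iff_map_eq_zero]
      intro y hy
      obtain ⟨r, rfl⟩ := Ideal.Quotient.mk_surjective y
      have hy' : Ideal.Quotient.mk P (x * r) = 0 := hy
      rw [Ideal.Quotient.eq_zero_iff_mem] at hy' ⊢
      exact (hP.mem_or_mem hy').resolve_left hx
    · intro y
      obtain ⟨r, rfl⟩ := Ideal.Quotient.mk_surjective y
      exact ⟨Ideal.Quotient.mk P r, rfl⟩
    · intro y hy
      obtain ⟨r, rfl⟩ := Ideal.Quotient.mk_surjective y
      have hy' : Ideal.Quotient.mk (P ⊔ Ideal.span {x}) r = 0 := hy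
      rw [Ideal.Quotient.eq_zero_iff_mem, Submodule.mem_sup] at hy'
      obtain ⟨a, ha, b, hb, rfl⟩ := hy'
      obtain ⟨c, rfl⟩ := Ideal.mem_span_singleton'.mp hb
      refine ⟨Ideal.Quotient.mk P c, ?_⟩
      show Ideal.Quotient.mk P (x * c) = _
      rw [Ideal.Quotient.eq, mul_comm]
      simpa using ha
  obtain ⟨δ, hδ⟩ := ses_tri hS
  refine ⟨ModuleCat.ofHom g, δ, ?_⟩
  have : (Sg R).map (ModuleCat.ofHom f) = x • 𝟙 ((Sg R).obj (ModuleCat.of R (R ⧸ P))) := by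
    rw [← CategoryTheory.Functor.map_id, ← Functor.map_smul]
    rfl
  rw [← this]
  exact hδ

lemma V_mul {P : Ideal R} (hP : P.IsPrime) {x : R} (hx : x ∉ P) (j j' : ℤ) (hj : 1 + j = j') :
    ∃ f : VV j' ((Sg R).obj (ModuleCat.of R (R ⧸ P))) →ₗ[R]
        VV j ((Sg R).obj (ModuleCat.of R (R ⧸ (P ⊔ Ideal.span {x})))),
      (∀ v, f v = 0 → ∃ w, v = x • w) ∧
      ∃ g : VV j ((Sg R).obj (ModuleCat.of R (R ⧸ (P ⊔ Ideal.span {x})))) →ₗ[R]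
        VV j ((Sg R).obj (ModuleCat.of R (R ⧸ P))),
      (∀ v, g v = 0 → ∃ w, f w = v) ∧ (∀ v, x • v = 0 → ∃ w, g w = v) := by
  obtain ⟨π, δ, hT⟩ := mul_tri P hP x hx
  refine ⟨Vd δ j j' hj, fun v hv => ?_, Vp j ((Sg R).map π), fun v hv => ?_, fun v hv => ?_⟩
  · obtain ⟨w, hw⟩ : ∃ w, Vp j' (x • 𝟙 ((Sg R).obj (ModuleCat.of R (R ⧸ P)))) w = v :=
      vex1 hT j j' hj v hv
    exact ⟨w, by rw [← hw, Vp_smul, Vp_id]⟩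
  · exact vex3 hT j j' hj v hv
  · refine vex2 hT j v ?_
    show Vp j (x • 𝟙 ((Sg R).obj (ModuleCat.of R (R ⧸ P)))) v = 0
    rw [Vp_smul, Vp_id, hv]

lemma quo_kill (J : Ideal R) : ∀ a ∈ J, ∀ x : ModuleCat.of R (R ⧸ J), a • x = 0 := by
  intro a ha x
  obtain ⟨r, rfl⟩ := Ideal.Quotient.mk_surjective (I := J) x
  show Ideal.Quotient.mk J (a * r) = 0
  rw [Ideal.Quotient.eq_zero_iff_mem]
  exact Ideal.mul_mem_right _ _ ha

lemma lt_of_sup {P P' : Ideal R} {x : R} (hx : x ∉ P) (h : P ⊔ Ideal.span {x} ≤ P') : P < P' :=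
  lt_of_le_of_ne (le_sup_left.trans h) fun he => hx (by
    rw [he]; exact h (le_sup_right (a := P) (Ideal.mem_span_singleton_self x)))

/-- the generator of `G^0(k)` -/
lemma G_k_zero : ∃ g0 : GG 0 ((Sg R).obj (ModuleCat.of R (R ⧸ maximalIdeal R))), g0 ≠ 0 ∧
    (∀ a ∈ maximalIdeal R, a • g0 = 0) ∧ ∀ g, ∃ r : R, g = r • g0 := by
  have hk := quo_kill (maximalIdeal R)
  let one : ModuleCat.of R (R ⧸ maximalIdeal R) := (Ideal.Quotient.mk _ 1 : R ⧸ maximalIdeal R)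
  obtain ⟨g0, hg0⟩ := Gev_surj (maximalIdeal R) (ModuleCat.of R (R ⧸ maximalIdeal R))
    one 1 (fun a ha => hk a (by simpa using ha) _)
  have hinj := Gev_inj (maximalIdeal R) (ModuleCat.of R (R ⧸ maximalIdeal R))
  refine ⟨g0, ?_, fun a ha => hinj ?_, fun g => ?_⟩
  · rintro rfl
    rw [map_zero] at hg0
    have : Ideal.Quotient.mk (maximalIdeal R) 1 = 0 := hg0.symm
    rw [map_one] at this
    exact one_ne_zero this
  · rw [map_smul, map_zero, hk a ha]
  · obtain ⟨r, hr⟩ := Ideal.Quotient.mk_surjective (I := maximalIdeal R)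
      (Gev (maximalIdeal R) (ModuleCat.of R (R ⧸ maximalIdeal R)) g)
    refine ⟨r, hinj ?_⟩
    rw [map_smul, hg0, ← hr]
    show _ = Ideal.Quotient.mk _ (r * 1)
    rw [mul_one]

lemma V_k_fin [IsNoetherianRing R] (j : ℤ) :
    Module.Finite R (VV j ((Sg R).obj (ModuleCat.of R (R ⧸ maximalIdeal R)))) := by
  rcases lt_trichotomy j 0 with hj | rfl | hj
  · have := Gm_neg (maximalIdeal R) (ModuleCat.of R (R ⧸ maximalIdeal R)) j hj
    infer_instance
  · obtain ⟨g0, -, hk, hg⟩ := G_k_zero (R := R)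
    obtain ⟨e, -, -, he⟩ := EE_soc R
    let f : VV 0 ((Sg R).obj (ModuleCat.of R (R ⧸ maximalIdeal R))) →ₗ[R]
      Submodule.span R {e} := (LinearMap.applyₗ g0).codRestrict _ (fun v => by
        obtain ⟨r, hr⟩ := he (v g0) (fun x hx => by rw [← map_smul, hk x hx, map_zero])
        rw [LinearMap.applyₗ_apply_apply, hr]
        exact Submodule.smul_mem _ _ (Submodule.mem_span_singleton_self e))
    have : Module.Finite R (Submodule.span R {e}) := Module.Finite.span_singleton R e
    refine Module.Finite.of_injective f ?_
    rw [injective_iff_map_eq_zero]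
    intro v hv
    have hv' : v g0 = 0 := congrArg Subtype.val hv
    ext g
    obtain ⟨r, rfl⟩ := hg g
    rw [map_smul, hv', smul_zero]
    rfl
  · have := Gm_torsion (maximalIdeal R) (ModuleCat.of R (R ⧸ maximalIdeal R))
      (fun x => ⟨1, fun a ha => quo_kill _ a (by simpa using ha) x⟩) j hj
    infer_instance

lemma exists_mem_max {P : Ideal R} (hP : P.IsPrime) (h : P ≠ maximalIdeal R) :
    ∃ x ∈ maximalIdeal R, x ∉ P := by
  by_contra hc
  push Not at hc
  exact h (le_antisymm (le_maximalIdeal hP.ne_top) hc)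

section noeth
variable [IsNoetherianRing R] [IsAdicComplete (maximalIdeal R) R]

lemma V_fin_prime (P : Ideal R) (hP : P.IsPrime) :
    ∀ j : ℤ, Module.Finite R (VV j ((Sg R).obj (ModuleCat.of R (R ⧸ P)))) := by
  refine prime_ind (fun P => ∀ j : ℤ, Module.Finite R (VV j ((Sg R).obj (ModuleCat.of R (R ⧸ P))))) ?_ P hP
  intro P hP ih j
  by_cases hm : P = maximalIdeal R
  · subst hm; exact V_k_fin j
  obtain ⟨x, hxm, hx⟩ := exists_mem_max hP hm
  have hf : Module.Finite R (VV (j-1) ((Sg R).obj (ModuleCat.of R (R ⧸ (P ⊔ Ideal.span {x}))))) :=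
    devV (fun V _ _ => Module.Finite R V) (fun A B C _ _ _ _ _ _ f g h hA hC => finite_mid hA hC f g h)
      (fun A _ _ _ => inferInstance) (j - 1) (P ⊔ Ideal.span {x})
      (fun P' hP' hle => ih P' hP' (lt_of_sup hx hle) _) _ (quo_kill _)
  obtain ⟨f, hf, -⟩ := V_mul hP hx (j - 1) j (by ring)
  exact finite_of_sep hxm (V_sep hxm j _) f hf

/-- (a) -/
lemma V_fin (N : ModuleCat.{u} R) [Module.Finite R N] (j : ℤ) :
    Module.Finite R (VV j ((Sg R).obj N)) :=
  devV (fun V _ _ => Module.Finite R V) (fun A B C _ _ _ _ _ _ f g h hA hC => finite_mid hA hC f g h)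
      (fun A _ _ _ => inferInstance) j ⊥
      (fun P' hP' _ => V_fin_prime P' hP' j) N
      (fun a ha x => by rw [Ideal.mem_bot.mp ha, zero_smul])

lemma V_top_aux (j : ℤ) (J : Ideal R) (hprime : ∀ P : Ideal R, P.IsPrime → J ≤ P →
      Subsingleton (VV j ((Sg R).obj (ModuleCat.of R (R ⧸ P)))))
    (N : ModuleCat.{u} R) [Module.Finite R N] (hN : ∀ a ∈ J, ∀ x : N, a • x = 0) :
    Subsingleton (VV j ((Sg R).obj N)) :=
  devV (fun V _ _ => Subsingleton V) (fun A B C _ _ _ _ _ _ f g h hA hC => 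
      subsingleton_of_forall_eq 0 fun b => by
        obtain ⟨a, rfl⟩ := h b (Subsingleton.elim _ _)
        rw [Subsingleton.elim a 0, map_zero]) 
      (fun A _ _ h => h) j J hprime N hN

/-- (b) -/
lemma V_top (P : Ideal R) (hP : P.IsPrime) :
    ∀ j : ℤ, (dd P : ℤ) < j → Subsingleton (VV j ((Sg R).obj (ModuleCat.of R (R ⧸ P)))) := by
  refine prime_ind (fun P => ∀ j : ℤ, (dd P : ℤ) < j →
    Subsingleton (VV j ((Sg R).obj (ModuleCat.of R (R ⧸ P))))) ?_ P hP
  intro P hP ih j hj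
  by_cases hm : P = maximalIdeal R
  · subst hm
    have := Gm_torsion (maximalIdeal R) (ModuleCat.of R (R ⧸ maximalIdeal R))
      (fun x => ⟨1, fun a ha => quo_kill _ a (by simpa using ha) x⟩) j (by omega)
    infer_instance
  obtain ⟨x, hxm, hx⟩ := exists_mem_max hP hm
  have hf : Subsingleton (VV (j-1) ((Sg R).obj (ModuleCat.of R (R ⧸ (P ⊔ Ideal.span {x}))))) :=
    V_top_aux (j - 1) (P ⊔ Ideal.span {x})
      (fun P' hP' hle => ih P' hP' (lt_of_sup hx hle) _ (by
        have := dd_lt hP hP' (lt_of_sup hx hle)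
        omega)) _ (quo_kill _)
  obtain ⟨f, hf, -⟩ := V_mul hP hx (j - 1) j (by ring)
  choose w hw using fun v => hf v (Subsingleton.elim _ _)
  refine subsingleton_of_forall_eq 0 fun v => ?_
  exact V_sep hxm j _ (fun n => w^[n] v) (fun n => by
    rw [Function.iterate_succ_apply']; exact hw _)

lemma dd_max : dd (maximalIdeal R) = 0 := by
  have h := dd_coe (maximalIdeal R) (Ideal.IsPrime.ne_top inferInstance)
  rw [ringKrullDim_eq_zero_of_isField ((Ideal.Quotient.maximal_ideal_iff_isField_quotient _).mp
    inferInstance)] at h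
  exact_mod_cast h.symm

lemma V_low_prime (P : Ideal R) (hP : P.IsPrime) : ∀ (j : ℤ) (p : Ideal R), p.IsPrime → j < dd p →
    Kill p (VV j ((Sg R).obj (ModuleCat.of R (R ⧸ P)))) := by
  refine prime_ind (fun P => ∀ (j : ℤ) (p : Ideal R), p.IsPrime → j < dd p →
    Kill p (VV j ((Sg R).obj (ModuleCat.of R (R ⧸ P))))) ?_ P hP
  intro P hP ih j p hp hj
  by_cases hPp : P ≤ p
  swap
  · obtain ⟨s, hsP, hsp⟩ := SetLike.not_le_iff_exists.mp hPp
    exact ⟨s, hsp, V_smul_of_kill j (quo_kill P s hsP)⟩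
  rcases lt_or_ge j 0 with hj0 | hj0
  · have := Gm_neg (maximalIdeal R) (ModuleCat.of R (R ⧸ P)) j hj0
    exact Kill.of_subsingleton hp.ne_top
  have hpm : p ≠ maximalIdeal R := by
    rintro rfl
    have h0 := dd_max (R := R)
    omega
  obtain ⟨x, hxm, hx⟩ := exists_mem_max hp hpm
  obtain ⟨p', hp', hle, hxp', hd⟩ := exists_dd_succ hp hxm hx
  have hxP : x ∉ P := fun h => hx (hPp h)
  have hk : Kill p' (VV (j-1) ((Sg R).obj (ModuleCat.of R (R ⧸ (P ⊔ Ideal.span {x}))))) :=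
    devV (fun V _ _ => Kill p' V) (fun A B C _ _ _ _ _ _ f g h hA hC => hA.mid hp' hC f g h)
      (fun A _ _ _ => Kill.of_subsingleton hp'.ne_top) (j - 1) (P ⊔ Ideal.span {x})
      (fun P' hP' hle => ih P' hP' (lt_of_sup hxP hle) _ p' hp' (by omega)) _ (quo_kill _)
  obtain ⟨s, hs, hk⟩ := hk
  obtain ⟨f, hf, -⟩ := V_mul hP hxP (j - 1) j (by ring)
  have := V_fin_prime P hP j
  refine (kill_nak hp' (I := Ideal.span {x}) ?_ hs fun v => ?_).mono hle
  · rwa [Ideal.span_singleton_le_iff_mem]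
  · obtain ⟨w, hw⟩ := hf (s • v) (by rw [map_smul, hk])
    rw [hw]
    exact Submodule.smul_mem_smul (Ideal.mem_span_singleton_self x) Submodule.mem_top

/-- (c) -/
lemma V_low (N : ModuleCat.{u} R) [Module.Finite R N] (j : ℤ) (p : Ideal R) (hp : p.IsPrime)
    (hj : j < dd p) : Kill p (VV j ((Sg R).obj N)) :=
  devV (fun V _ _ => Kill p V) (fun A B C _ _ _ _ _ _ f g h hA hC => hA.mid hp hC f g h)
      (fun A _ _ _ => Kill.of_subsingleton hp.ne_top) j ⊥
      (fun P' hP' _ => V_low_prime P' hP' j p hp hj) N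
      (fun a ha x => by rw [Ideal.mem_bot.mp ha, zero_smul])

end noeth
end CofPf

set_option linter.unusedSectionVars false

namespace CofPf
open CategoryTheory Limits Pretriangulated Opposite IsLocalRing

variable {R : Type u} [CommRing R] [IsLocalRing R] [IsNoetherianRing R]
  [IsAdicComplete (maximalIdeal R) R]

lemma not_kill_aux {P : Ideal R} (hP : P.IsPrime)
    (h : ¬ Subsingleton (VV (dd P) ((Sg R).obj (ModuleCat.of R (R ⧸ P))))) :
    ¬ Kill P (VV (dd P) ((Sg R).obj (ModuleCat.of R (R ⧸ P)))) := by
  rintro ⟨x, hx, hk⟩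
  obtain ⟨f, -, g, hg, hg'⟩ := V_mul hP hx (dd P) (1 + dd P) rfl
  have : Subsingleton (VV (dd P) ((Sg R).obj (ModuleCat.of R (R ⧸ (P ⊔ Ideal.span {x}))))) :=
    V_top_aux _ (P ⊔ Ideal.span {x})
      (fun P' hP' hle => V_top P' hP' _ (by
        have := dd_lt hP hP' (lt_of_sup hx hle)
        omega)) _ (quo_kill _)
  refine h (subsingleton_of_forall_eq 0 fun v => ?_)
  obtain ⟨w, rfl⟩ := hg' v (hk v)
  rw [Subsingleton.elim w 0, map_zero]

lemma avoid (P : Ideal R) (hP : P.IsPrime) (hPm : P ≠ maximalIdeal R) (s : Set (Ideal R))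
    (hs : s.Finite) (hsp : ∀ Q ∈ s, Q.IsPrime) :
    ∃ x ∈ maximalIdeal R, x ∉ P ∧ ∀ Q ∈ s, Q ≠ maximalIdeal R → x ∉ Q := by
  by_contra hc
  push Not at hc
  classical
  let t : Finset (Ideal R) := (insert P hs.toFinset).filter (· ≠ maximalIdeal R)
  have ht : ∀ Q ∈ t, Q.IsPrime ∧ Q ≠ maximalIdeal R := by
    intro Q hQ
    simp only [t, Finset.mem_filter, Finset.mem_insert, Set.Finite.mem_toFinset] at hQ
    refine ⟨?_, hQ.2⟩
    rcases hQ.1 with rfl | h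
    · exact hP
    · exact hsp Q h
  have hsub : (maximalIdeal R : Set R) ⊆ ⋃ Q ∈ (t : Set (Ideal R)), (Q : Set R) := by
    intro x hx
    simp only [Set.mem_iUnion, exists_prop]
    by_cases hxP : x ∈ P
    · exact ⟨P, by simp [t, hPm], hxP⟩
    · obtain ⟨Q, hQ, hQm, hxQ⟩ := hc x hx hxP
      exact ⟨Q, by simp [t, hQ, hQm], hxQ⟩
  obtain ⟨Q, hQ, hle⟩ := (Ideal.subset_union_prime (f := fun Q : Ideal R => Q) P P
    (fun Q hQ _ _ => (ht Q hQ).1)).mp hsub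
  exact (ht Q hQ).2 (le_antisymm (le_maximalIdeal (ht Q hQ).1.ne_top) hle)

lemma V_top_ne (P : Ideal R) (hP : P.IsPrime) :
    ¬ Subsingleton (VV (dd P) ((Sg R).obj (ModuleCat.of R (R ⧸ P)))) := by
  refine prime_ind (fun P => ¬ Subsingleton (VV (dd P) ((Sg R).obj (ModuleCat.of R (R ⧸ P))))) ?_ P hP
  intro P hP ih hsub
  by_cases hm : P = maximalIdeal R
  · subst hm
    obtain ⟨g0, hg0, -⟩ := G_k_zero (R := R)
    obtain ⟨f, hf⟩ := EE_cogen (R := R) g0 hg0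
    rw [dd_max] at hsub
    exact hf (by rw [hsub.elim f (0 : VV 0 _)]; rfl)
  have hWf := V_fin_prime P hP (dd P - 1)
  set W := VV (dd P - 1) ((Sg R).obj (ModuleCat.of R (R ⧸ P))) with hW
  obtain ⟨x, hxm, hx, hav⟩ := avoid P hP hm (Module.annihilator R W).minimalPrimes
    (Ideal.finite_minimalPrimes_of_isNoetherianRing R _) (fun Q hQ => hQ.1.1)
  obtain ⟨P', hP', hle, hxP', hd⟩ := exists_dd_succ hP hxm hx
  have hlt : P < P' := lt_of_le_of_ne hle (fun h => hx (h ▸ hxP'))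
  have hne := ih P' hP' hlt
  have hnk := not_kill_aux hP' hne
  have hJ : P ⊔ Ideal.span {x} ≤ P' := sup_le hle (by rwa [Ideal.span_singleton_le_iff_mem])
  have hdd : ((dd P : ℤ) - 1) = (dd P' : ℤ) := by omega
  obtain ⟨f, hf, g, hg, -⟩ := V_mul hP hx (dd P - 1) (dd P) (by ring)
  -- embedding
  have hemb : ∃ ι : VV (dd P') ((Sg R).obj (ModuleCat.of R (R ⧸ P'))) →ₗ[R] W,
      Function.Injective ι := by
    let π : (R ⧸ (P ⊔ Ideal.span {x})) →ₗ[R] (R ⧸ P') := Submodule.mapQ _ _ LinearMap.id hJ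
    have hπ : Function.Surjective π := by
      intro y
      obtain ⟨r, rfl⟩ := Ideal.Quotient.mk_surjective y
      exact ⟨Ideal.Quotient.mk _ r, rfl⟩
    have hS := LinearMap.shortExact_shortComplexKer hπ
    obtain ⟨δ, hT⟩ := ses_tri hS
    have h0 : Subsingleton (VV (dd P) ((Sg R).obj (ModuleCat.of R (LinearMap.ker π)))) :=
      V_top_aux _ (P ⊔ Ideal.span {x})
        (fun P' hP' hle => V_top P' hP' _ (by
          have := dd_lt hP hP' (lt_of_sup hx hle)
          omega)) _ (fun a ha y => Subtype.ext (quo_kill _ a ha y.1))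
    have h1 : Function.Injective (Vp (dd P - 1) ((Sg R).map (ModuleCat.ofHom π))) := by
      rw [injective_iff_map_eq_zero]
      intro v hv
      obtain ⟨w, hw⟩ : ∃ w : VV (dd P) ((Sg R).obj (ModuleCat.of R (LinearMap.ker π))),
          Vd δ (dd P - 1) (dd P) (by ring) w = v := vex3 hT (dd P - 1) (dd P) (by ring) v hv
      rw [← hw, h0.elim w 0]
      exact map_zero _
    have h2 : Function.Injective g := by
      rw [injective_iff_map_eq_zero]
      intro v hv
      obtain ⟨w, rfl⟩ := hg v hv
      rw [hsub.elim w 0, map_zero]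
    rw [← hdd]
    exact ⟨g.comp (Vp (dd P - 1) ((Sg R).map (ModuleCat.ofHom π))), h2.comp h1⟩
  obtain ⟨ι, hι⟩ := hemb
  by_cases hd1 : dd P' = 0
  · apply hne
    have : Subsingleton (VV (dd P - 1 - 1) ((Sg R).obj
        (ModuleCat.of R (R ⧸ (P ⊔ Ideal.span {x}))))) := by
      have := Gm_neg (maximalIdeal R) (ModuleCat.of R (R ⧸ (P ⊔ Ideal.span {x})))
        (dd P - 1 - 1) (by omega)
      infer_instance
    obtain ⟨f', hf', -⟩ := V_mul hP hx (dd P - 1 - 1) (dd P - 1) (by ring)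
    have hW0 : ∀ w : W, w = 0 := by
      choose w hw using fun v => hf' v (Subsingleton.elim _ _)
      intro v
      exact V_sep hxm _ _ (fun n => w^[n] v) (fun n => by
        rw [Function.iterate_succ_apply']; exact hw _)
    exact subsingleton_of_forall_eq 0 fun v => hι (by rw [hW0 (ι v), map_zero])
  have hnW : ¬ Kill P' W := fun h => hnk (h.of_inj ι hι)
  have ha : Module.annihilator R W ≤ P' := by
    intro s hs
    by_contra hsP
    exact hnW ⟨s, hsP, fun v => Module.mem_annihilator.mp hs v⟩
  obtain ⟨Q, hQ, hQP⟩ := Ideal.exists_minimalPrimes_le ha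
  have hQm : Q ≠ maximalIdeal R := by
    rintro rfl
    have : P' = maximalIdeal R := le_antisymm (le_maximalIdeal hP'.ne_top) hQP
    rw [this] at hd1
    exact hd1 dd_max
  have hxQ := hav Q hQ hQm
  have hQlt : Q < P' := lt_of_le_of_ne hQP (fun h => hxQ (h ▸ hxP'))
  have := dd_lt hQ.1.1 hP' hQlt
  obtain ⟨s, hsQ, hs⟩ := V_low (ModuleCat.of R (R ⧸ P)) (dd P - 1) Q hQ.1.1 (by omega)
  exact hsQ (hQ.1.2 (Module.mem_annihilator.mpr hs))

lemma not_kill {P : Ideal R} (hP : P.IsPrime) :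
    ¬ Kill P (VV (dd P) ((Sg R).obj (ModuleCat.of R (R ⧸ P)))) :=
  not_kill_aux hP (V_top_ne P hP)

end CofPf

set_option linter.unusedSectionVars false

namespace CofPf
open CategoryTheory Limits Pretriangulated Opposite IsLocalRing

section gen
variable {R : Type u} [CommRing R]

/-- coherent complexes -/
inductive Coh : Dc R → Prop
  | of (N : ModuleCat.{u} R) (h : Module.Finite R N) : Coh ((Sg R).obj N)
  | sh (X : Dc R) (n : ℤ) (h : Coh X) : Coh (X⟦n⟧)
  | iso (X Y : Dc R) (e : X ≅ Y) (h : Coh X) : Coh Y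
  | ext (T : Triangle (Dc R)) (hT : T ∈ distTriang (Dc R)) (h₁ : Coh T.obj₁) (h₃ : Coh T.obj₃) :
      Coh T.obj₂

/-- factorisation -/
def Fac (Z : Dc R) : Prop := ∀ (L : ModuleCat.{u} R) (s : ℤ) (f : Z ⟶ ((Sg R).obj L)⟦s⟧),
  ∃ (N : ModuleCat.{u} R) (π : L ⟶ N), Function.Surjective π.hom ∧ (LinearMap.ker π.hom).FG ∧
    f ≫ ((Sg R).map π)⟦s⟧' = 0

lemma fac_single_nat [IsNoetherianRing R] (j : ℕ) : ∀ (A : ModuleCat.{u} R) [Module.Finite R A]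
    (L : ModuleCat.{u} R) (f : (Sg R).obj A ⟶ ((Sg R).obj L)⟦(j:ℤ)⟧),
    ∃ (N : ModuleCat.{u} R) (π : L ⟶ N), Function.Surjective π.hom ∧ (LinearMap.ker π.hom).FG ∧
    f ≫ ((Sg R).map π)⟦(j:ℤ)⟧' = 0 := by
  induction j with
  | zero =>
    intro A _ L f
    obtain ⟨φ, rfl⟩ := hom_zero_surj A L f
    refine ⟨ModuleCat.of R (L ⧸ LinearMap.range φ.hom),
      ModuleCat.ofHom (Submodule.mkQ (LinearMap.range φ.hom)), Submodule.mkQ_surjective _, ?_, ?_⟩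
    · have : LinearMap.ker (ModuleCat.ofHom (Submodule.mkQ (LinearMap.range φ.hom))).hom =
        LinearMap.range φ.hom := Submodule.ker_mkQ _
      rw [this, LinearMap.range_eq_map]
      exact (Module.Finite.fg_top (R := R) (M := A)).map _
    · have h0 : φ ≫ ModuleCat.ofHom (Submodule.mkQ (LinearMap.range φ.hom)) = 0 := by
        ext x
        exact (Submodule.Quotient.mk_eq_zero _).mpr ⟨x, rfl⟩
      have := (shiftFunctorZero (Dc R) ℤ).inv.naturality
        ((Sg R).map (ModuleCat.ofHom (Submodule.mkQ (LinearMap.range φ.hom))))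
      rw [Category.assoc]
      erw [← this]
      rw [← Category.assoc]
      erw [← Functor.map_comp]
      rw [h0, Functor.map_zero, zero_comp]
  | succ j ih =>
    intro A _ L f
    obtain ⟨n, p, hp⟩ := Module.Finite.exists_fin' R A
    have hS := LinearMap.shortExact_shortComplexKer (f := p) hp
    obtain ⟨δ, hT⟩ := ses_tri hS
    have hP : Projective (ModuleCat.of R (Fin n → R)) := inferInstance
    obtain ⟨δ', g, hg⟩ : ∃ (δ' : (Sg R).obj A ⟶ ((Sg R).obj (ModuleCat.of R (LinearMap.ker p)))⟦(1:ℤ)⟧)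
        (g : (Sg R).obj (ModuleCat.of R (LinearMap.ker p)) ⟶ ((Sg R).obj L)⟦(j:ℤ)⟧),
        f = δ' ≫ g⟦(1:ℤ)⟧' ≫ (shiftFunctorAdd' (Dc R) (j : ℤ) 1 ((j+1 : ℕ) : ℤ)
          (by push_cast; rfl)).inv.app ((Sg R).obj L) :=
      ⟨δ, delta_factor hT (X := (Sg R).obj L) (j : ℤ) ((j+1 : ℕ) : ℤ) (by push_cast; rfl) f
      (hom_proj _ _ _ (by omega) _)⟩
    obtain ⟨N, π, h1, h2, h3⟩ := ih (ModuleCat.of R (LinearMap.ker p)) L g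
    refine ⟨N, π, h1, h2, ?_⟩
    have := (shiftFunctorAdd' (Dc R) (j:ℤ) 1 ((j+1 : ℕ) : ℤ) (by push_cast; rfl)).inv.naturality ((Sg R).map π)
    rw [hg, Category.assoc, Category.assoc, ← this]
    simp only [Functor.comp_map]
    rw [← Category.assoc (g⟦(1:ℤ)⟧'), ← Functor.map_comp]
    erw [h3]
    rw [Functor.map_zero, zero_comp, comp_zero]

lemma Coh.fac [IsNoetherianRing R] {Z : Dc R} (h : Coh Z) : Fac Z := by
  induction h with
  | of A hA =>
    intro L s f
    rcases lt_or_ge s 0 with hs | hs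
    · refine ⟨L, 𝟙 L, fun x => ⟨x, rfl⟩, ?_, ?_⟩
      · have : LinearMap.ker (ModuleCat.Hom.hom (𝟙 L)) = ⊥ := LinearMap.ker_id
        rw [this]
        exact Submodule.fg_bot
      · rw [hom_neg _ _ s hs f, zero_comp]
    · obtain ⟨n, rfl⟩ := Int.eq_ofNat_of_zero_le hs
      exact fac_single_nat n A L f
  | sh X n h ih =>
    intro L s f
    let e := shiftFunctorAdd' (Dc R) (s - n) n s (by omega)
    obtain ⟨g, hg⟩ := (shiftFunctor (Dc R) n).map_surjective (f ≫ e.hom.app _)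
    obtain ⟨N, π, h1, h2, h3⟩ := ih L (s - n) g
    refine ⟨N, π, h1, h2, ?_⟩
    have h4 := congrArg (fun t => (shiftFunctor (Dc R) n).map t) h3
    simp only [Functor.map_comp, Functor.map_zero] at h4
    rw [hg] at h4
    have h5 := e.hom.naturality ((Sg R).map π)
    rw [Category.assoc] at h4
    erw [← h5] at h4
    rw [← Category.assoc] at h4
    exact (cancel_mono (e.hom.app _)).mp (h4.trans zero_comp.symm)
  | iso X Y e h ih =>
    intro L s f
    obtain ⟨N, π, h1, h2, h3⟩ := ih L s (e.hom ≫ f)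
    refine ⟨N, π, h1, h2, ?_⟩
    rwa [Category.assoc, ← cancel_epi e.inv, e.inv_hom_id_assoc, comp_zero] at h3
  | ext T hT _ _ ih1 ih3 =>
    intro L s f
    obtain ⟨N, π, h1, h2, h3⟩ := ih1 L s (T.mor₁ ≫ f)
    rw [Category.assoc] at h3
    obtain ⟨g, hg⟩ := Triangle.yoneda_exact₂ T hT _ h3
    obtain ⟨N', π', h1', h2', h3'⟩ := ih3 N s g
    refine ⟨N', π ≫ π', h1'.comp h1, ?_, ?_⟩
    · exact Submodule.fg_ker_comp _ _ h2 h2' h1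
    · rw [Functor.map_comp, Functor.map_comp, ← Category.assoc, hg, Category.assoc, h3', comp_zero]
end gen

variable {R : Type u} [CommRing R] [IsLocalRing R] 

/-- shift -/
noncomputable def VVshift (j n : ℤ) (X : Dc R) : VV j (X⟦n⟧) ≃ₗ[R] VV (n + j) X :=
  LinearEquiv.congrLeft (EE R) R
    (Gequiv R (Tw (maximalIdeal R)) ((shiftFunctorAdd' (Dc R) n j (n+j) rfl).app X)).symm

lemma Coh.V_fin [IsNoetherianRing R]
  [IsAdicComplete (maximalIdeal R) R] {Z : Dc R} (h : Coh Z) : ∀ j, Module.Finite R (VV j Z) := by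
  induction h with
  | of A hA => exact fun j => CofPf.V_fin A j
  | sh X n h ih => exact fun j => have := ih (n + j); Module.Finite.equiv (VVshift j n X).symm
  | iso X Y e h ih => exact fun j => have := ih j; Module.Finite.equiv (Vequiv j e).symm
  | ext T hT _ _ ih1 ih3 =>
    exact fun j => finite_mid (ih3 j) (ih1 j) (Vp j T.mor₂) (Vp j T.mor₁) (vex2 hT j)

end CofPf

set_option linter.unusedSectionVars false

namespace CofPf
open CategoryTheory Limits Pretriangulated Opposite IsLocalRing

variable {R : Type u} [CommRing R]

lemma tri_ge1 {X Y Z : Dc R} {f : X ⟶ Y} {g : Y ⟶ Z} {h : Z ⟶ X⟦(1:ℤ)⟧}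
    (hT : Triangle.mk f g h ∈ distTriang (Dc R)) (n m : ℤ) (hm : n ≤ m + 1)
    (hY : DerivedCategory.TStructure.t.IsGE Y n) (hZ : DerivedCategory.TStructure.t.IsGE Z m) : DerivedCategory.TStructure.t.IsGE X n := by
  have h1 := inv_rot_of_distTriang _ hT
  have : DerivedCategory.TStructure.t.IsGE (Z⟦(-1:ℤ)⟧) (m + 1) := DerivedCategory.TStructure.t.isGE_shift Z m (-1) (m+1) (by omega)
  exact DerivedCategory.TStructure.t.isGE₂ _ h1 n (DerivedCategory.TStructure.t.isGE_of_ge (Z⟦(-1:ℤ)⟧) n (m+1) hm) hY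

lemma tri_le1 {X Y Z : Dc R} {f : X ⟶ Y} {g : Y ⟶ Z} {h : Z ⟶ X⟦(1:ℤ)⟧}
    (hT : Triangle.mk f g h ∈ distTriang (Dc R)) (n m : ℤ) (hm : m + 1 ≤ n)
    (hY : DerivedCategory.TStructure.t.IsLE Y n) (hZ : DerivedCategory.TStructure.t.IsLE Z m) : DerivedCategory.TStructure.t.IsLE X n := by
  have h1 := inv_rot_of_distTriang _ hT
  have : DerivedCategory.TStructure.t.IsLE (Z⟦(-1:ℤ)⟧) (m + 1) := DerivedCategory.TStructure.t.isLE_shift Z m (-1) (m+1) (by omega)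
  exact DerivedCategory.TStructure.t.isLE₂ _ h1 n (DerivedCategory.TStructure.t.isLE_of_le (Z⟦(-1:ℤ)⟧) (m+1) n hm) hY

lemma tri_le3 {X Y Z : Dc R} {f : X ⟶ Y} {g : Y ⟶ Z} {h : Z ⟶ X⟦(1:ℤ)⟧}
    (hT : Triangle.mk f g h ∈ distTriang (Dc R)) (n m : ℤ) (hm : m ≤ n + 1)
    (hY : DerivedCategory.TStructure.t.IsLE Y n) (hX : DerivedCategory.TStructure.t.IsLE X m) : DerivedCategory.TStructure.t.IsLE Z n := by
  have h1 := rot_of_distTriang _ hT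
  have : DerivedCategory.TStructure.t.IsLE (X⟦(1:ℤ)⟧) (m - 1) := DerivedCategory.TStructure.t.isLE_shift X m (1) (m-1) (by omega)
  exact DerivedCategory.TStructure.t.isLE₂ _ h1 n hY (DerivedCategory.TStructure.t.isLE_of_le (X⟦(1:ℤ)⟧) (m-1) n (by omega))

/-- scalars acting by zero -/
noncomputable def Nl (X : Dc R) : Ideal R := LinearMap.ker (LinearMap.toSpanSingleton R (X ⟶ X) (𝟙 X))

lemma mem_Nl {X : Dc R} {a : R} : a ∈ Nl X ↔ a • 𝟙 X = 0 := Iff.rfl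

lemma Nl_smul {X Y : Dc R} {a : R} (ha : a ∈ Nl X) (f : X ⟶ Y) : a • f = 0 := by
  rw [← Category.id_comp f, ← Linear.smul_comp, mem_Nl.mp ha, zero_comp]
lemma Nl_smul' {X Y : Dc R} {a : R} (ha : a ∈ Nl X) (f : Y ⟶ X) : a • f = 0 := by
  rw [← Category.comp_id f, ← Linear.comp_smul, mem_Nl.mp ha, comp_zero]
lemma Nl_iso {X Y : Dc R} (e : X ≅ Y) : Nl X ≤ Nl Y := by
  intro a ha
  rw [mem_Nl, ← e.inv_hom_id, ← Linear.smul_comp, Nl_smul' ha, zero_comp]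
lemma Nl_shift {X : Dc R} (n : ℤ) : Nl X ≤ Nl (X⟦n⟧) := by
  intro a ha
  rw [mem_Nl, ← CategoryTheory.Functor.map_id, ← Functor.map_smul, mem_Nl.mp ha, Functor.map_zero]
lemma Nl_single {N : ModuleCat.{u} R} {a : R} (ha : a ∈ Nl ((Sg R).obj N)) (x : N) : a • x = 0 := by
  have : a • 𝟙 N = 0 := by
    apply (Sg R).map_injective
    rw [Functor.map_smul, CategoryTheory.Functor.map_id, mem_Nl.mp ha, Functor.map_zero]
  exact congrArg (fun t : N ⟶ N => t.hom x) this

lemma Nl_fib {X Y Z : Dc R} {f : X ⟶ Y} {g : Y ⟶ Z} {h : Z ⟶ X⟦(1:ℤ)⟧}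
    (hT : Triangle.mk f g h ∈ distTriang (Dc R)) {z : R} (h1 : z • f = 0) (h2 : z • h = 0) :
    z * z ∈ Nl X := by
  obtain ⟨k, hk⟩ : ∃ k : X⟦(1:ℤ)⟧ ⟶ Z, z • 𝟙 (X⟦(1:ℤ)⟧) = k ≫ h :=
    Triangle.coyoneda_exact₁ _ hT (z • 𝟙 (X⟦(1:ℤ)⟧)) (by
      show (z • 𝟙 (X⟦(1:ℤ)⟧)) ≫ f⟦(1:ℤ)⟧' = 0
      rw [Linear.smul_comp, Category.id_comp, ← Functor.map_smul, h1, Functor.map_zero])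
  apply Functor.map_injective (shiftFunctor (Dc R) (1:ℤ))
  show (shiftFunctor (Dc R) (1:ℤ)).map ((z * z) • 𝟙 X) = _
  rw [Functor.map_smul, CategoryTheory.Functor.map_id, mul_smul, hk, ← Linear.comp_smul, h2, comp_zero,
    Functor.map_zero]

/-- `Ext(R/I,X)` finite -/
def Phi (I : Ideal R) (X : Dc R) : Prop :=
  ∀ i : ℤ, Module.Finite R ((Sg R).obj (ModuleCat.of R (R ⧸ I)) ⟶ X⟦i⟧)

variable [IsNoetherianRing R]

lemma phi1 {I : Ideal R} {X Y Z : Dc R} {f : X ⟶ Y} {g : Y ⟶ Z} {h : Z ⟶ X⟦(1:ℤ)⟧}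
    (hT : Triangle.mk f g h ∈ distTriang (Dc R)) (h1 : Phi I Y) (h2 : Phi I Z) : Phi I X := by
  intro i
  exact finite_mid (h2 (i - 1)) (h1 i) (Linear.rightComp R _ (dl h (i-1) i (by ring)))
    (Linear.rightComp R _ (f⟦i⟧')) (fun b hb => hex1 hT (i-1) i (by ring) b hb)

lemma phi3 {I : Ideal R} {X Y Z : Dc R} {f : X ⟶ Y} {g : Y ⟶ Z} {h : Z ⟶ X⟦(1:ℤ)⟧}
    (hT : Triangle.mk f g h ∈ distTriang (Dc R)) (h1 : Phi I Y) (h2 : Phi I X) : Phi I Z := by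
  intro i
  exact finite_mid (h1 i) (h2 (1 + i)) (Linear.rightComp R _ (g⟦i⟧'))
    (Linear.rightComp R _ (dl h i (1+i) rfl)) (fun b hb => hex3 hT i (1+i) rfl b hb)

lemma phi_fg (I : Ideal R) (N : ModuleCat.{u} R) : ∀ _ : Module.Finite R N, Phi I ((Sg R).obj N) := 
  fun _ i => hom_fin _ _ i

lemma phi_shift {I : Ideal R} {X : Dc R} (h : Phi I X) (n : ℤ) : Phi I (X⟦n⟧) := by
  intro i
  have := h (n + i)
  exact finite_mid this (inferInstance : Module.Finite R PUnit.{u+1})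
    (Linear.rightComp R _ ((shiftFunctorAdd' (Dc R) n i (n+i) rfl).hom.app X)) 0
    (fun b _ => ⟨b ≫ (shiftFunctorAdd' (Dc R) n i (n+i) rfl).inv.app X, by
      rw [Linear.rightComp_apply]
      rw [Category.assoc, Iso.inv_hom_id_app]
      exact Category.comp_id b⟩)

lemma phi_iso {I : Ideal R} {X Y : Dc R} (e : X ≅ Y) (h : Phi I X) : Phi I Y := by
  intro i
  exact finite_mid (h i) (inferInstance : Module.Finite R PUnit.{u+1})
    (Linear.rightComp R _ (e.hom⟦i⟧')) 0 (fun b _ => ⟨b ≫ e.inv⟦i⟧', by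
      rw [Linear.rightComp_apply]
      rw [Category.assoc, ← Functor.map_comp, e.inv_hom_id, CategoryTheory.Functor.map_id,
        Category.comp_id]⟩)

lemma fg_tors (I : Ideal R) (N : Type u) [AddCommGroup N] [Module R N]
    (h : Module.Finite R (Submodule.torsionBySet R N (I : Set R))) (n : ℕ) :
    Module.Finite R (Submodule.torsionBySet R N ((I ^ n : Ideal R) : Set R)) := by
  induction n with
  | zero =>
    have : Subsingleton (Submodule.torsionBySet R N ((I ^ 0 : Ideal R) : Set R)) := by
      refine subsingleton_of_forall_eq 0 fun x => Subtype.ext ?_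
      have := (Submodule.mem_torsionBySet_iff _ _).mp x.2 ⟨1, by simp⟩
      simpa using this
    infer_instance
  | succ n ih =>
    obtain ⟨s, hs⟩ := (inferInstance : IsNoetherianRing R).noetherian I
    have hsI : ∀ a : s, (a : R) ∈ I := fun a => hs ▸ Submodule.subset_span a.2
    let f : Submodule.torsionBySet R N (I : Set R) →ₗ[R]
      Submodule.torsionBySet R N ((I ^ (n+1) : Ideal R) : Set R) :=
      Submodule.inclusion (Submodule.torsionBySet_le_torsionBySet_of_subset
        (Ideal.pow_le_self (by omega)))
    let g : Submodule.torsionBySet R N ((I ^ (n+1) : Ideal R) : Set R) →ₗ[R]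
      (s → Submodule.torsionBySet R N ((I ^ n : Ideal R) : Set R)) :=
      LinearMap.pi fun a => LinearMap.codRestrict _ ((a : R) • Submodule.subtype _) (by
        intro c
        rw [Submodule.mem_torsionBySet_iff]
        intro b
        show (b : R) • (a : R) • (c : N) = 0
        rw [smul_smul]
        exact (Submodule.mem_torsionBySet_iff _ _).mp c.2 ⟨b * a, by
          show _ ∈ I ^ (n+1)
          rw [pow_succ]; exact Ideal.mul_mem_mul b.2 (hsI a)⟩)
    refine finite_mid h (inferInstance : Module.Finite R (s → _)) f g ?_
    intro b hb
    refine ⟨⟨b, ?_⟩, rfl⟩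
    have hle : I ≤ LinearMap.ker (LinearMap.toSpanSingleton R N (b : N)) := by
      refine hs.symm.le.trans (Submodule.span_le.mpr ?_)
      intro a ha
      have := congrArg Subtype.val (congrFun hb ⟨a, ha⟩)
      exact this
    rw [Submodule.mem_torsionBySet_iff]
    exact fun a => hle a.2

lemma fg_of_phi {I : Ideal R} (N : ModuleCat.{u} R) 
    (h0 : Module.Finite R ((Sg R).obj (ModuleCat.of R (R ⧸ I)) ⟶ ((Sg R).obj N)⟦(0:ℤ)⟧)) (K : ℕ)
    (hK : ∀ a ∈ I ^ K, ∀ x : N, a • x = 0) : Module.Finite R N := by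
  have h1 : Module.Finite R (Submodule.torsionBySet R N (I : Set R)) := by
    let f : ((Sg R).obj (ModuleCat.of R (R ⧸ I)) ⟶ ((Sg R).obj N)⟦(0:ℤ)⟧) →ₗ[R] N :=
      (LinearMap.applyₗ (Ideal.Quotient.mk I 1 : R ⧸ I)).comp (ev0 (ModuleCat.of R (R ⧸ I)) N)
    have hle : Submodule.torsionBySet R N (I : Set R) ≤ LinearMap.range f := by
      intro x hx
      rw [Submodule.mem_torsionBySet_iff] at hx
      let φ : (R ⧸ I) →ₗ[R] N := Submodule.liftQ I (LinearMap.toSpanSingleton R N x)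
        (fun a ha => hx ⟨a, ha⟩)
      refine ⟨_, (LinearMap.congr_fun (ev0_apply (ModuleCat.of R (R ⧸ I)) N (ModuleCat.ofHom φ))
        (Ideal.Quotient.mk I 1)).trans ?_⟩
      show (1:R) • x = x
      exact one_smul _ _
    have h2 : IsNoetherian R (LinearMap.range f) := inferInstance
    exact Module.Finite.of_injective (Submodule.inclusion hle) (Submodule.inclusion_injective hle)
  have h2 := fg_tors I N h1 K
  have h3 : Submodule.torsionBySet R N ((I ^ K : Ideal R) : Set R) = ⊤ := by
    rw [eq_top_iff]
    intro x _
    rw [Submodule.mem_torsionBySet_iff]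
    exact fun a => hK a a.2 x
  rw [h3] at h2
  exact Module.Finite.equiv Submodule.topEquiv

lemma coh_of_phi (I : Ideal R) (n : ℕ) : ∀ (X : Dc R) (c : ℤ), DerivedCategory.TStructure.t.IsGE X c →
    DerivedCategory.TStructure.t.IsLE X (c + n - 1) → Phi I X → I ≤ (Nl X).radical → Coh X := by
  induction n with
  | zero =>
    intro X c h1 h2 _ _
    have h0 : IsZero X := DerivedCategory.TStructure.t.isZero X (c + (0:ℕ) - 1) c (by omega)
    have h3 : IsZero ((Sg R).obj (ModuleCat.of R PUnit.{u+1})) :=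
      Functor.map_isZero _ (ModuleCat.isZero_of_subsingleton _)
    exact Coh.iso _ _ (h3.iso h0) (Coh.of _ inferInstance)
  | succ n ih =>
    intro X c h1 h2 h3 h4
    obtain ⟨A, B, hA, hB, f, g, h, hT⟩ := DerivedCategory.TStructure.t.exists_triangle X c (c+1) rfl
    rw [DerivedCategory.TStructure.t.le_iff_isLE] at hA
    rw [DerivedCategory.TStructure.t.ge_iff_isGE] at hB
    have hA' : DerivedCategory.TStructure.t.IsGE A c := tri_ge1 hT c (c+1) (by omega) h1 hB
    have hB' : DerivedCategory.TStructure.t.IsLE B (c + (n+1:ℕ) - 1) := tri_le3 hT _ c (by omega) h2 hA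
    have hnA : Nl X ≤ Nl A := by
      intro a ha
      have hT' := inv_rot_of_distTriang _ hT
      have h5 : (a • 𝟙 A) ≫ f = 0 := by rw [Linear.smul_comp, Nl_smul' ha]
      obtain ⟨k, hk⟩ : ∃ k : A ⟶ B⟦(-1:ℤ)⟧, a • 𝟙 A = k ≫ _ :=
        Triangle.coyoneda_exact₂ _ hT' (a • 𝟙 A) h5
      have : DerivedCategory.TStructure.t.IsGE (B⟦(-1:ℤ)⟧) (c + 2) := DerivedCategory.TStructure.t.isGE_shift B (c+1) (-1) (c+2) (by omega)
      have hk0 : k = 0 := DerivedCategory.TStructure.t.zero k c (c+2) (by omega)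
      rw [mem_Nl, hk, hk0]
      exact zero_comp
    have hnB : Nl X ≤ Nl B := by
      intro a ha
      have h5 : g ≫ (a • 𝟙 B) = 0 := by rw [Linear.comp_smul, Nl_smul ha]
      obtain ⟨k, hk⟩ : ∃ k : A⟦(1:ℤ)⟧ ⟶ B, a • 𝟙 B = h ≫ k :=
        Triangle.yoneda_exact₃ _ hT (a • 𝟙 B) h5
      have : DerivedCategory.TStructure.t.IsLE (A⟦(1:ℤ)⟧) (c - 1) := DerivedCategory.TStructure.t.isLE_shift A c 1 (c-1) (by omega)
      have hk0 : k = 0 := DerivedCategory.TStructure.t.zero k (c-1) (c+1) (by omega)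
      rw [mem_Nl, hk, hk0, comp_zero]
    obtain ⟨K, hK⟩ := Ideal.exists_pow_le_of_le_radical_of_fg h4
      ((inferInstance : IsNoetherianRing R).noetherian I)
    have hg0 : DerivedCategory.TStructure.t.IsGE (A⟦c⟧) 0 := DerivedCategory.TStructure.t.isGE_shift A c c 0 (by omega)
    have hl0 : DerivedCategory.TStructure.t.IsLE (A⟦c⟧) 0 := DerivedCategory.TStructure.t.isLE_shift A c c 0 (by omega)
    obtain ⟨N, ⟨e⟩⟩ := DerivedCategory.exists_iso_singleFunctor_obj_of_isGE_of_isLE (A⟦c⟧) 0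
    have hNk : ∀ a ∈ I ^ K, ∀ x : N, a • x = 0 := fun a ha x =>
      Nl_single (Nl_iso e (Nl_shift c (hnA (hK ha)))) x
    -- finiteness
    have hN0 : Module.Finite R ((Sg R).obj (ModuleCat.of R (R ⧸ I)) ⟶ A⟦c⟧) := by
      have hBc : DerivedCategory.TStructure.t.IsGE (B⟦c - 1⟧) 2 := DerivedCategory.TStructure.t.isGE_shift B (c+1) (c-1) 2 (by omega)
      have hs : Subsingleton ((Sg R).obj (ModuleCat.of R (R ⧸ I)) ⟶ B⟦c-1⟧) :=
        subsingleton_of_forall_eq 0 fun k => DerivedCategory.TStructure.t.zero k 0 2 (by omega)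
      exact finite_mid (inferInstance : Module.Finite R ((Sg R).obj (ModuleCat.of R (R ⧸ I)) ⟶ B⟦c-1⟧))
        (h3 c) (Linear.rightComp R _ (dl h (c-1) c (by ring)))
        (Linear.rightComp R _ (f⟦c⟧')) (fun b hb => hex1 hT (c-1) c (by ring) b hb)
    have hNf : Module.Finite R N := by
      refine fg_of_phi N ?_ K hNk
      let e' : A⟦c⟧ ≅ ((Sg R).obj N)⟦(0:ℤ)⟧ := e ≪≫ ((shiftFunctorZero (Dc R) ℤ).app _).symm
      exact finite_mid hN0 (inferInstance : Module.Finite R PUnit.{u+1})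
        (Linear.rightComp R _ e'.hom) 0 (fun b _ => ⟨b ≫ e'.inv, by
          rw [Linear.rightComp_apply, Category.assoc, e'.inv_hom_id, Category.comp_id]⟩)
    have hAe : (((Sg R).obj N)⟦-c⟧) ≅ A :=
      (shiftFunctor (Dc R) (-c)).mapIso e.symm ≪≫ (shiftFunctorCompIsoId (Dc R) c (-c) (by omega)).app A
    have hcA : Coh A := Coh.iso _ _ hAe (Coh.sh _ _ (Coh.of N hNf))
    have hpA : Phi I A := phi_iso hAe (phi_shift (phi_fg I N hNf) _)
    exact Coh.ext _ hT hcA (ih B (c+1) hB (by convert hB' using 1; push_cast; ring) (phi3 hT h3 hpA)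
      (h4.trans (Ideal.radical_mono hnB)))

end CofPf

set_option linter.unusedSectionVars false

namespace CofPf
open CategoryTheory Limits Pretriangulated Opposite IsLocalRing

section
variable {R : Type u} [CommRing R] [IsNoetherianRing R]

/-- bounded with finite Ext -/
def Bd (I : Ideal R) (X : Dc R) : Prop :=
  (∃ c, DerivedCategory.TStructure.t.IsGE X c) ∧ (∃ e, DerivedCategory.TStructure.t.IsLE X e) ∧ Phi I X

lemma fib_exists (X : Dc R) (y : R) : ∃ (X' : Dc R) (φ : X' ⟶ X) (h : X ⟶ X'⟦(1:ℤ)⟧),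
    Triangle.mk φ (y • 𝟙 X) h ∈ distTriang (Dc R) := distinguished_cocone_triangle₁ (y • 𝟙 X)

lemma fib_bd {I : Ideal R} {X X' : Dc R} {y : R} {φ : X' ⟶ X} {h : X ⟶ X'⟦(1:ℤ)⟧}
    (hT : Triangle.mk φ (y • 𝟙 X) h ∈ distTriang (Dc R)) (hX : Bd I X) : Bd I X' := by
  obtain ⟨⟨c, hc⟩, ⟨e, he⟩, hp⟩ := hX
  refine ⟨⟨c, tri_ge1 hT c c (by omega) hc hc⟩, ⟨e + 1, tri_le1 hT (e+1) e (by omega) ?_ he⟩,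
    phi1 hT hp hp⟩
  exact DerivedCategory.TStructure.t.isLE_of_le X e (e+1) (by omega)

lemma fib_nl {X X' : Dc R} {y : R} {φ : X' ⟶ X} {h : X ⟶ X'⟦(1:ℤ)⟧}
    (hT : Triangle.mk φ (y • 𝟙 X) h ∈ distTriang (Dc R)) :
    (Nl X).radical ≤ (Nl X').radical ∧ y ∈ (Nl X').radical := by
  constructor
  · rw [Ideal.radical_le_radical_iff]
    intro z hz
    exact ⟨2, by rw [pow_two]; exact Nl_fib hT (Nl_smul' hz _) (Nl_smul hz _)⟩
  · refine ⟨2, ?_⟩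
    rw [pow_two]
    refine Nl_fib hT ?_ ?_
    · have : φ ≫ (y • 𝟙 X) = 0 := comp_distTriang_mor_zero₁₂ _ hT
      rwa [Linear.comp_smul, Category.comp_id] at this
    · have : (y • 𝟙 X) ≫ h = 0 := comp_distTriang_mor_zero₂₃ _ hT
      rwa [Linear.smul_comp, Category.id_comp] at this

lemma coh_of_bd {I : Ideal R} {X : Dc R} (h : Bd I X) (hn : I ≤ (Nl X).radical) : Coh X := by
  obtain ⟨⟨c, hc⟩, ⟨e, he⟩, hp⟩ := h
  refine coh_of_phi I (e - c + 1).toNat X c hc ?_ hp hn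
  exact DerivedCategory.TStructure.t.isLE_of_le X e _ (by omega)

lemma sup_step {I : Ideal R} {X X' : Dc R} {x : R} {l : List R}
    (h1 : (Nl X).radical ≤ (Nl X').radical) (h2 : x ∈ (Nl X').radical)
    (hI : I ≤ (Nl X).radical ⊔ Ideal.span {y | y ∈ x :: l}) :
    I ≤ (Nl X').radical ⊔ Ideal.span {y | y ∈ l} := by
  refine hI.trans (sup_le (h1.trans le_sup_left) ?_)
  rw [Ideal.span_le]
  intro y hy
  rcases List.mem_cons.mp hy with rfl | hy
  · exact Ideal.mem_sup_left h2
  · exact Ideal.mem_sup_right (Ideal.subset_span hy)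
end

variable {R : Type u} [CommRing R] [IsLocalRing R] [IsNoetherianRing R]
  [IsAdicComplete (maximalIdeal R) R]

lemma fib_ker {X X' : Dc R} {y : R} {φ : X' ⟶ X} {h : X ⟶ X'⟦(1:ℤ)⟧}
    (hT : Triangle.mk φ (y • 𝟙 X) h ∈ distTriang (Dc R)) (j : ℤ) (v : VV j X) (hv : Vp j φ v = 0) :
    ∃ v', v = y • v' := by
  obtain ⟨w, hw⟩ : ∃ w : VV j X, Vp j (y • 𝟙 X) w = v := vex2 hT j v hv
  exact ⟨w, by rw [← hw, Vp_smul, Vp_id]⟩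

lemma V_fin_bd {I : Ideal R} (hIm : I ≤ maximalIdeal R) (l : List R) (hl : ∀ x ∈ l, x ∈ I) :
    ∀ (X : Dc R), Bd I X → I ≤ (Nl X).radical ⊔ Ideal.span {y | y ∈ l} →
    ∀ j, Module.Finite R (VV j X) := by
  induction l with
  | nil =>
    intro X hX hI
    exact (coh_of_bd hX (by simpa using hI)).V_fin
  | cons x l ih =>
    intro X hX hI j
    obtain ⟨X', φ, h, hT⟩ := fib_exists X x
    obtain ⟨h1, h2⟩ := fib_nl hT
    have := ih (fun y hy => hl y (List.mem_cons_of_mem _ hy)) X' (fib_bd hT hX)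
      (sup_step h1 h2 hI) j
    have hxm := hIm (hl x List.mem_cons_self)
    exact finite_of_sep hxm (fun u hu => V_sep hxm j X u hu) (Vp j φ) (fib_ker hT j)

lemma V_ker {I : Ideal R} (hIm : I ≤ maximalIdeal R) (j : ℤ) (l : List R) (hl : ∀ x ∈ l, x ∈ I) :
    ∀ (X : Dc R), Bd I X → I ≤ (Nl X).radical ⊔ Ideal.span {y | y ∈ l} → ∀ N : ℕ,
    ∃ (X' : Dc R) (φ : X' ⟶ X), Coh X' ∧ ∀ v : VV j X, Vp j φ v = 0 →
      v ∈ ((Ideal.span {y | y ∈ l}) ^ N • ⊤ : Submodule R (VV j X)) := by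
  induction l with
  | nil =>
    intro X hX hI N
    refine ⟨X, 𝟙 X, coh_of_bd hX (by simpa using hI), fun v hv => ?_⟩
    rw [Vp_id] at hv
    rw [hv]
    exact zero_mem _
  | cons x l ih =>
    intro X hX hI N
    obtain ⟨X₁, φ, h, hT⟩ := fib_exists X (x ^ N)
    obtain ⟨h1, h2⟩ := fib_nl hT
    have hl' : ∀ y ∈ l, y ∈ I := fun y hy => hl y (List.mem_cons_of_mem _ hy)
    have h2' : x ∈ (Nl X₁).radical := by
      rw [← Ideal.radical_idem]
      exact ⟨N, h2⟩
    have hI₁ := sup_step h1 h2' hI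
    have hB₁ := fib_bd hT hX
    have hf := V_fin_bd hIm l hl' X₁ hB₁ hI₁ j
    set J := Ideal.span {y | y ∈ l} with hJ
    obtain ⟨k, hk⟩ := Ideal.exists_pow_inf_eq_pow_smul J (LinearMap.range (Vp j φ))
    obtain ⟨X', ψ, hc, hψ⟩ := ih hl' X₁ hB₁ hI₁ (N + k)
    refine ⟨X', ψ ≫ φ, hc, fun v hv => ?_⟩
    rw [Vp_comp] at hv
    have h3 := hψ _ hv
    have h4 : Vp j φ v ∈ (J ^ N • LinearMap.range (Vp j φ) : Submodule R (VV j X₁)) := by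
      have h5 : Vp j φ v ∈ (J ^ (N + k) • ⊤ ⊓ LinearMap.range (Vp j φ) : Submodule R (VV j X₁)) :=
        ⟨h3, v, rfl⟩
      rw [hk (N+k) (by omega), Nat.add_sub_cancel] at h5
      exact (Submodule.smul_mono le_rfl inf_le_right) h5
    rw [LinearMap.range_eq_map, ← Submodule.map_smul''] at h4
    obtain ⟨w, hw, hwv⟩ := h4
    obtain ⟨v', hv'⟩ := fib_ker hT j (v - w) (by rw [map_sub, hwv, sub_self])
    have hJl : J ≤ Ideal.span {y | y ∈ x :: l} :=
      Ideal.span_mono fun y hy => List.mem_cons_of_mem _ hy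
    rw [← sub_add_cancel v w, hv']
    refine add_mem (Submodule.smul_mem_smul (Ideal.pow_mem_pow (Ideal.subset_span (show x ∈ {y | y ∈ x :: l} from List.mem_cons_self)) N)
      Submodule.mem_top) ?_
    exact (Submodule.smul_mono_left (Ideal.pow_right_mono hJl N)) hw

/-- main result of step 4 -/
lemma kill_cofinite {I P q : Ideal R} (hIm : I ≤ maximalIdeal R) (hq : q.IsPrime) (hIq : I ≤ q)
    (hmin : ∀ Q : Ideal R, Q.IsPrime → I ≤ Q → P ≤ Q → Q ≤ q → Q = q) (a : ℤ) (ha : a ≠ dd q)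
    (L : ModuleCat.{u} R) (hL : Tor I L) (hLP : ∀ s ∈ P, ∀ x : L, s • x = 0)
    (hphi : Phi I ((Sg R).obj L)) : Kill q (VV a ((Sg R).obj L)) := by
  obtain ⟨s, hs⟩ := (inferInstance : IsNoetherianRing R).noetherian I
  have hsp : Ideal.span {y | y ∈ s.toList} = I := by
    simpa using hs
  have hl : ∀ x ∈ s.toList, x ∈ I := fun x hx => hsp ▸ Ideal.subset_span hx
  have hI' : I ≤ (Nl ((Sg R).obj L)).radical ⊔ Ideal.span {y | y ∈ s.toList} := by
    rw [hsp]; exact le_sup_right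
  have hbd : Bd I ((Sg R).obj L) := ⟨⟨0, inferInstance⟩, ⟨0, inferInstance⟩, hphi⟩
  have hfin := V_fin_bd hIm s.toList hl _ hbd hI' a
  obtain ⟨X', φ, hc, hker⟩ := V_ker hIm a s.toList hl _ hbd hI' 1
  rw [hsp, pow_one] at hker
  obtain ⟨N, π, hπ, hfg, h0⟩ := hc.fac L 0 (φ ≫ (shiftFunctorZero (Dc R) ℤ).inv.app ((Sg R).obj L))
  have h0' : φ ≫ (Sg R).map π = 0 := by
    have := (shiftFunctorZero (Dc R) ℤ).inv.naturality ((Sg R).map π)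
    rw [Category.assoc] at h0
    erw [← this] at h0
    rw [← Category.assoc] at h0
    exact (cancel_mono ((shiftFunctorZero (Dc R) ℤ).inv.app _)).mp (h0.trans zero_comp.symm)
  have hS := LinearMap.shortExact_shortComplexKer (f := π.hom) hπ
  obtain ⟨δ, hT⟩ := ses_tri hS
  obtain ⟨ψ, ι, hψ⟩ : ∃ (ψ : X' ⟶ (Sg R).obj (ModuleCat.of R (LinearMap.ker π.hom)))
      (ι : (Sg R).obj (ModuleCat.of R (LinearMap.ker π.hom)) ⟶ (Sg R).obj L), φ = ψ ≫ ι := by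
    obtain ⟨ψ, hψ⟩ := Triangle.coyoneda_exact₂ _ hT φ h0'
    exact ⟨ψ, _, hψ⟩
  have hfg' : Module.Finite R (LinearMap.ker π.hom) := Module.Finite.iff_fg.mpr hfg
  obtain ⟨n, hn⟩ := tor_map hL (LinearMap.ker π.hom).subtype
  have hkill : Kill q (VV a ((Sg R).obj (ModuleCat.of R (LinearMap.ker π.hom)))) := by
    refine devV (fun V _ _ => Kill q V) ?_ ?_ a (I ^ n ⊔ P) ?_
      (ModuleCat.of R (LinearMap.ker π.hom)) ?_
    · intro A B C _ _ _ _ _ _ f g hfg hA hC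
      exact Kill.mid hq hA hC f g hfg
    · intro A _ _ _
      exact Kill.of_subsingleton hq.ne_top
    · intro Q hQ hle
      have hIQ : I ≤ Q := hQ.le_of_pow_le (le_sup_left.trans hle)
      have hPQ : P ≤ Q := le_sup_right.trans hle
      by_cases hQq : Q ≤ q
      · have := hmin Q hQ hIQ hPQ hQq
        subst this
        rcases lt_or_gt_of_ne ha with h | h
        · exact V_low _ _ _ hQ h
        · have := V_top Q hQ a h
          exact Kill.of_subsingleton hq.ne_top
      · obtain ⟨x, hxQ, hxq⟩ := SetLike.not_le_iff_exists.mp hQq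
        exact ⟨x, hxq, V_smul_of_kill a (quo_kill Q x hxQ)⟩
    · intro c hc x
      obtain ⟨b, hb, d, hd, rfl⟩ := Submodule.mem_sup.mp hc
      apply Subtype.ext
      show (b + d) • (x : L) = 0
      rw [add_smul, hLP d hd, add_zero]
      exact hn (b • x) (Submodule.smul_mem_smul hb Submodule.mem_top)
  obtain ⟨t, ht, hk⟩ := hkill
  refine kill_nak hq hIq ht fun v => hker _ ?_
  rw [hψ, Vp_comp, map_smul, hk, map_zero]

end CofPf

set_option linter.unusedSectionVars false

namespace CofPf
open CategoryTheory Limits Pretriangulated Opposite IsLocalRing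

variable {R : Type u} [CommRing R]

lemma mono_hi (K : ChainComplex (ModuleCat.{u} R)ᵒᵖ ℕ) (n : ℕ) : Mono (K.homologyι n) := by
  infer_instance

lemma epi_po (K : ChainComplex (ModuleCat.{u} R)ᵒᵖ ℕ) (n : ℕ) : Epi (K.pOpcycles n) := by
  infer_instance

/-- complex of homs, in the opposite category -/
noncomputable def KK {X : ModuleCat.{u} R} (P : ProjectiveResolution X) (Y : ModuleCat.{u} R) :
    ChainComplex (ModuleCat.{u} R)ᵒᵖ ℕ :=
  ((((linearYoneda R (ModuleCat.{u} R)).obj Y).rightOp.mapHomologicalComplex _).obj P.complex)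

/-- cocycles -/
noncomputable def WW {X : ModuleCat.{u} R} (P : ProjectiveResolution X) (Y : ModuleCat.{u} R) (n : ℕ) :
    ModuleCat.{u} R := ((KK P Y).opcycles n).unop

/-- inclusion of cocycles -/
noncomputable def pk {X : ModuleCat.{u} R} (P : ProjectiveResolution X) (Y : ModuleCat.{u} R) (n : ℕ) :
    WW P Y n ⟶ ModuleCat.of R (P.complex.X n ⟶ Y) := ((KK P Y).pOpcycles n).unop

/-- projection to Ext -/
noncomputable def hk {X : ModuleCat.{u} R} (P : ProjectiveResolution X) (Y : ModuleCat.{u} R) (n : ℕ) :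
    WW P Y n ⟶ ((Ext R (ModuleCat.{u} R) n).obj (op X)).obj Y :=
  ((P.isoLeftDerivedObj ((linearYoneda R (ModuleCat.{u} R)).obj Y).rightOp n).hom ≫
    (KK P Y).homologyι n).unop

section
variable {X : ModuleCat.{u} R} (P : ProjectiveResolution X) (Y : ModuleCat.{u} R) (n : ℕ)

lemma KK_d (i j : ℕ) : ((KK P Y).d i j).unop =
    ModuleCat.ofHom (Linear.leftComp R Y (P.complex.d i j)) := rfl

lemma pk_inj : Function.Injective (pk P Y n) := by
  have : Mono (pk P Y n) := by
    have := epi_po (KK P Y) n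
    exact unop_mono_of_epi _
  exact (ModuleCat.mono_iff_injective _).1 this

lemma hk_surj : Function.Surjective (hk P Y n) := by
  have : Epi (hk P Y n) := by
    have hm := mono_hi (KK P Y) n
    have : Mono ((P.isoLeftDerivedObj ((linearYoneda R (ModuleCat.{u} R)).obj Y).rightOp n).hom ≫
      (KK P Y).homologyι n) := mono_comp' inferInstance hm
    exact unop_epi_of_mono _
  exact (ModuleCat.epi_iff_surjective _).1 this

lemma pk_d (w : WW P Y n) : P.complex.d (n+1) n ≫ (show P.complex.X n ⟶ Y from pk P Y n w) = 0 := by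
  have h := congrArg Quiver.Hom.unop ((KK P Y).d_pOpcycles (n+1) n)
  exact LinearMap.congr_fun (congrArg ModuleCat.Hom.hom h) w

lemma pk_surj (f : P.complex.X n ⟶ Y) (hf : P.complex.d (n+1) n ≫ f = 0) :
    ∃ w, pk P Y n w = f := by
  have hprev : (ComplexShape.down ℕ).prev n = n+1 := by simp
  have h1 := ShortComplex.exact_of_g_is_cokernel
    (ShortComplex.mk _ _ ((KK P Y).d_pOpcycles (n+1) n)) ((KK P Y).opcyclesIsCokernel _ _ hprev)
  have h2 := (ShortComplex.moduleCat_exact_iff _).1 h1.unop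
  exact h2 f hf

lemma hk_zero (w : WW P Y n) : hk P Y n w = 0 ↔
    ∃ g : P.complex.X (n-1) ⟶ Y, P.complex.d n (n-1) ≫ g = pk P Y n w := by
  have hnext : (ComplexShape.down ℕ).next n = n-1 := by
    cases n <;> simp
  have h1 := ShortComplex.exact_of_f_is_kernel
    (ShortComplex.mk _ _ ((KK P Y).homologyι_comp_fromOpcycles n (n-1)))
    ((KK P Y).homologyIsKernel _ _ hnext)
  have h2 := (ShortComplex.moduleCat_exact_iff _).1 h1.unop
  have h4 : ∀ g : P.complex.X (n-1) ⟶ Y, pk P Y n ((((KK P Y).fromOpcycles n (n-1)).unop).hom g) =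
      P.complex.d n (n-1) ≫ g := by
    intro g
    have h := congrArg Quiver.Hom.unop ((KK P Y).p_fromOpcycles n (n-1))
    exact LinearMap.congr_fun (congrArg ModuleCat.Hom.hom h) g
  have h5 : hk P Y n w = 0 ↔ (((KK P Y).homologyι n).unop).hom w = 0 := by
    have : hk P Y n = ((KK P Y).homologyι n).unop ≫
      ((P.isoLeftDerivedObj ((linearYoneda R (ModuleCat.{u} R)).obj Y).rightOp n).hom).unop := rfl
    rw [this]
    have hi : Function.Injective ((P.isoLeftDerivedObj ((linearYoneda R (ModuleCat.{u} R)).obj Y).rightOp n).hom).unop.hom :=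
      (ModuleCat.mono_iff_injective _).1 inferInstance
    exact ⟨fun h => hi (h.trans (map_zero _).symm), fun h => (congrArg (((P.isoLeftDerivedObj ((linearYoneda R (ModuleCat.{u} R)).obj Y).rightOp n).hom).unop.hom) h).trans (map_zero _)⟩
  constructor
  · intro h
    obtain ⟨g, hg⟩ := h2 w (h5.1 h)
    refine ⟨g, ?_⟩
    exact (h4 g).symm.trans (congrArg (pk P Y n) hg)
  · rintro ⟨g, hg⟩
    have := pk_inj P Y n ((h4 g).trans hg)
    rw [h5, ← this]
    have h := congrArg Quiver.Hom.unop ((KK P Y).homologyι_comp_fromOpcycles n (n-1))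
    exact LinearMap.congr_fun (congrArg ModuleCat.Hom.hom h) g

end

lemma hk_nat {X X' : ModuleCat.{u} R} (P : ProjectiveResolution X) (P' : ProjectiveResolution X')
    (Y : ModuleCat.{u} R) (n : ℕ) (f : X ⟶ X') (φ : ProjectiveResolution.Hom P P' f)
    (w' : WW P' Y n) : ∃ w : WW P Y n, pk P Y n w = φ.hom.f n ≫ (show P'.complex.X n ⟶ Y from pk P' Y n w') ∧
      hk P Y n w = ((Ext R (ModuleCat.{u} R) n).map f.op).app Y (hk P' Y n w') := by
  have hc : φ.hom.f 0 ≫ P'.π.f 0 = P.π.f 0 ≫ f := by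
    rw [φ.hom_f_zero_comp_π_f_zero]
    congr 1
  have hn := ProjectiveResolution.isoLeftDerivedObj_hom_naturality f P P' φ.hom hc
    ((linearYoneda R (ModuleCat.{u} R)).obj Y).rightOp n
  let ψ : KK P Y ⟶ KK P' Y := (((linearYoneda R (ModuleCat.{u} R)).obj Y).rightOp.mapHomologicalComplex _).map φ.hom
  refine ⟨(HomologicalComplex.opcyclesMap ψ n).unop.hom w', ?_, ?_⟩
  · have h := congrArg Quiver.Hom.unop (HomologicalComplex.p_opcyclesMap ψ n)
    exact LinearMap.congr_fun (congrArg ModuleCat.Hom.hom h) w'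
  · have h0 := HomologicalComplex.homologyι_naturality ψ n
    have h1 : (((linearYoneda R (ModuleCat.{u} R)).obj Y).rightOp.leftDerived n).map f ≫
      (P'.isoLeftDerivedObj ((linearYoneda R (ModuleCat.{u} R)).obj Y).rightOp n).hom ≫
      (KK P' Y).homologyι n = 
      ((P.isoLeftDerivedObj ((linearYoneda R (ModuleCat.{u} R)).obj Y).rightOp n).hom ≫
      (KK P Y).homologyι n) ≫ HomologicalComplex.opcyclesMap ψ n := by
      refine (Category.assoc _ _ _).symm.trans ?_
      refine (congrArg (· ≫ (KK P' Y).homologyι n) hn).trans ?_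
      refine (Category.assoc _ _ _).trans ?_
      refine Eq.trans ?_ (Category.assoc _ _ _).symm
      exact congrArg (_ ≫ ·) h0
    have h := congrArg Quiver.Hom.unop h1
    exact (LinearMap.congr_fun (congrArg ModuleCat.Hom.hom h) w').symm

section
variable {X : ModuleCat.{u} R} (P : ProjectiveResolution X) (Y : ModuleCat.{u} R) (n : ℕ)

lemma extMk_zero_iff (f : P.complex.X n ⟶ Y) (hf : P.complex.d (n+1) n ≫ f = 0) :
    P.extMk f (n+1) rfl hf = 0 ↔ ∃ g : P.complex.X (n-1) ⟶ Y, P.complex.d n (n-1) ≫ g = f := by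
  cases n with
  | succ k => exact P.extMk_eq_zero_iff f _ rfl hf k rfl
  | zero =>
    constructor
    · intro h
      refine ⟨0, ?_⟩
      simp only [← P.extEquivCohomologyClass.apply_eq_iff_eq,
        ProjectiveResolution.extEquivCohomologyClass_extMk,
        ProjectiveResolution.extEquivCohomologyClass_zero,
        CochainComplex.HomComplex.CohomologyClass.mk_eq_zero_iff] at h
      rw [CochainComplex.HomComplex.Cocycle.toSingleMk_mem_coboundaries_iff _ _ _ _ _ 1 (by simp)] at h
      obtain ⟨g, hg⟩ := h
      rw [comp_zero]
      have hz : IsZero (P.cochainComplex.X 1) := CochainComplex.isZero_of_isStrictlyLE _ 0 1 (by omega)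
      rw [hz.eq_of_src g 0, comp_zero] at hg
      rw [← cancel_epi (P.cochainComplexXIso (-((0:ℕ):ℤ)) 0 rfl).hom, ← hg, comp_zero]
    · rintro ⟨g, rfl⟩
      have : P.complex.d 0 (0-1) = 0 := P.complex.shape _ _ (by simp)
      simp [this]

/-- the map to the new Ext -/
noncomputable def mk : WW P Y n →ₗ[R] ((Sg R).obj X ⟶ ((Sg R).obj Y)⟦(n:ℤ)⟧) where
  toFun w := (P.extMk (show P.complex.X n ⟶ Y from pk P Y n w) (n+1) rfl (pk_d P Y n w)).hom
  map_add' x y := by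
    have : (show P.complex.X n ⟶ Y from pk P Y n (x+y)) =
      (show P.complex.X n ⟶ Y from pk P Y n x) + (show P.complex.X n ⟶ Y from pk P Y n y) :=
      map_add (pk P Y n).hom x y
    rw [← Abelian.Ext.add_hom, P.add_extMk _ _ _ _ (pk_d P Y n x) (pk_d P Y n y)]
    simp only [this]
  map_smul' r x := by
    have : (show P.complex.X n ⟶ Y from pk P Y n (r • x)) =
      (show P.complex.X n ⟶ Y from pk P Y n x) ≫ (r • 𝟙 Y) := by
      rw [Linear.comp_smul, Category.comp_id]
      exact map_smul (pk P Y n).hom r x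
    simp only [this]
    rw [← P.extMk_comp_mk₀ _ _ rfl (pk_d P Y n x) (r • 𝟙 Y), ← Abelian.Ext.smul_eq_comp_mk₀]
    exact map_smul (Abelian.Ext.homLinearEquiv (R := R) (X := X) (Y := Y) (n := n)) r _

lemma mk_apply (w : WW P Y n) : mk P Y n w =
  (P.extMk (show P.complex.X n ⟶ Y from pk P Y n w) (n+1) rfl (pk_d P Y n w)).hom := rfl

lemma mk_zero (w : WW P Y n) : mk P Y n w = 0 ↔ hk P Y n w = 0 := by
  rw [hk_zero]
  refine Iff.trans ?_ (extMk_zero_iff P Y n _ (pk_d P Y n w))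
  rw [mk_apply, ← Abelian.Ext.zero_hom]
  exact ⟨fun h => Abelian.Ext.ext h, fun h => by rw [h]⟩

lemma mk_surj : Function.Surjective (mk P Y n) := by
  intro f
  obtain ⟨α, rfl⟩ : ∃ α : Abelian.Ext X Y n, α.hom = f := 
    ⟨(Abelian.Ext.homEquiv (n := n)).symm f, Abelian.Ext.homEquiv.apply_symm_apply f⟩
  obtain ⟨f, hf, rfl⟩ := P.extMk_surjective α (n+1) rfl
  obtain ⟨w, hw⟩ := pk_surj P Y n f hf
  refine ⟨w, ?_⟩
  rw [mk_apply]
  subst hw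
  rfl

/-- comparison -/
noncomputable def thetaP : ((Ext R (ModuleCat.{u} R) n).obj (op X)).obj Y ≃ₗ[R]
    ((Sg R).obj X ⟶ ((Sg R).obj Y)⟦(n:ℤ)⟧) :=
  ((hk P Y n).hom.quotKerEquivOfSurjective (hk_surj P Y n)).symm.trans
    ((Submodule.quotEquivOfEq _ _ (by
      ext w
      exact (mk_zero P Y n w).symm)).trans
      ((mk P Y n).quotKerEquivOfSurjective (mk_surj P Y n)))

lemma thetaP_hk (w : WW P Y n) : thetaP P Y n (hk P Y n w) = mk P Y n w := by
  have : ((hk P Y n).hom.quotKerEquivOfSurjective (hk_surj P Y n)).symm (hk P Y n w) =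
    Submodule.Quotient.mk w := by
    rw [LinearEquiv.symm_apply_eq]; rfl
  simp only [thetaP, LinearEquiv.trans_apply]
  rw [this]
  rfl
end

/-- comparison -/
noncomputable def theta (X Y : ModuleCat.{u} R) (n : ℕ) : ((Ext R (ModuleCat.{u} R) n).obj (op X)).obj Y ≃ₗ[R]
    ((Sg R).obj X ⟶ ((Sg R).obj Y)⟦(n:ℤ)⟧) := thetaP (ProjectiveResolution.of X) Y n

lemma theta_nat {X X' : ModuleCat.{u} R} (Y : ModuleCat.{u} R) (n : ℕ) (f : X ⟶ X')
    (x : ((Ext R (ModuleCat.{u} R) n).obj (op X')).obj Y) :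
    theta X Y n (((Ext R (ModuleCat.{u} R) n).map f.op).app Y x) =
      (Sg R).map f ≫ theta X' Y n x := by
  obtain ⟨w', rfl⟩ := hk_surj (ProjectiveResolution.of X') Y n x
  let φ : ProjectiveResolution.Hom (ProjectiveResolution.of X) (ProjectiveResolution.of X') f :=
    ⟨ProjectiveResolution.lift f _ _, (ProjectiveResolution.lift_commutes_zero f _ _)⟩
  obtain ⟨w, hw, hw2⟩ := hk_nat _ _ Y n f φ w'
  rw [← hw2]
  refine (thetaP_hk _ Y n w).trans ?_
  refine Eq.trans ?_ (congrArg ((Sg R).map f ≫ ·) (thetaP_hk _ Y n w')).symm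
  rw [mk_apply, mk_apply]
  have h := ProjectiveResolution.mk₀_comp_extMk _ (n+1) rfl (pk_d _ Y n w') φ
  have h2 := congrArg Abelian.Ext.hom h
  rw [Abelian.Ext.comp_hom, Abelian.Ext.mk₀_hom, ShiftedHom.mk₀_comp] at h2
  refine Eq.trans ?_ h2.symm
  simp only [hw]

end CofPf

set_option linter.unusedSectionVars false

namespace CofPf
open CategoryTheory Limits Pretriangulated Opposite IsLocalRing

variable {R : Type u} [CommRing R]

lemma phi_of_ext (I : Ideal R) (L : ModuleCat.{u} R)
    (h : ∀ i : ℕ, Module.Finite R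
      (((Ext R (ModuleCat.{u} R) i).obj (Opposite.op (ModuleCat.of R (R ⧸ I)))).obj L)) :
    Phi I ((Sg R).obj L) := by
  intro i
  rcases lt_or_ge i 0 with hi | hi
  · have : Subsingleton ((Sg R).obj (ModuleCat.of R (R ⧸ I)) ⟶ ((Sg R).obj L)⟦i⟧) :=
      subsingleton_of_forall_eq 0 (hom_neg _ _ i hi)
    infer_instance
  · obtain ⟨n, rfl⟩ := Int.eq_ofNat_of_zero_le hi
    have := h n
    exact Module.Finite.equiv (theta (ModuleCat.of R (R ⧸ I)) L n)

lemma theta_tw (I : Ideal R) (M : ModuleCat.{u} R) (b : ℕ) {j j' : ℕᵒᵖᵒᵖ} (g : j ⟶ j')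
    (x : ((Ext R (ModuleCat.{u} R) b).obj (op ((localCohomology.ringModIdeals (localCohomology.idealPowersDiagram I)).obj j.unop))).obj M) :
    theta _ M b (((localCohomology.diagram (localCohomology.idealPowersDiagram I) b).map g).app M x) =
      (Tw I).map g.unop ≫ theta _ M b x :=
  theta_nat M b ((localCohomology.ringModIdeals (localCohomology.idealPowersDiagram I)).map g.unop) x

lemma lc_equiv (I : Ideal R) (M : ModuleCat.{u} R) (b : ℕ) :
    Nonempty ((localCohomology I b).obj M ≃ₗ[R] Gm R (Tw I) (((Sg R).obj M)⟦(b:ℤ)⟧)) := by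
  have : PreservesFilteredColimitsOfSize.{u,u} (forget (ModuleCat.{u} R)) := inferInstance
  have : PreservesFilteredColimitsOfSize.{0,0} (forget (ModuleCat.{u} R)) :=
    preservesFilteredColimitsOfSize_shrink.{0,u,0,u} _
  have hc := isColimitOfPreserves ((evaluation (ModuleCat.{u} R) (ModuleCat.{u} R)).obj M)
    (colimit.isColimit (localCohomology.diagram (localCohomology.idealPowersDiagram I) b))
  set cc := (((evaluation (ModuleCat.{u} R) (ModuleCat.{u} R)).obj M).mapCocone (colimit.cocone (localCohomology.diagram (localCohomology.idealPowersDiagram I) b))) with hcc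
  let th : ∀ n : ℕ, _ := fun n => theta ((localCohomology.ringModIdeals (localCohomology.idealPowersDiagram I)).obj (op n)) M b
  let ψn : ∀ n : ℕ, ((Tw I).obj (op n) ⟶ (((Sg R).obj M)⟦(b:ℤ)⟧)) →ₗ[R] cc.pt := fun n =>
    (cc.ι.app (op (op n))).hom.comp (th n).symm.toLinearMap
  have hψ : ∀ (i j : ℕ) (hij : i ≤ j) (x : (Tw I).obj (op i) ⟶ (((Sg R).obj M)⟦(b:ℤ)⟧)),
      ψn j ((Tw I).map (homOfLE hij).op ≫ x) = ψn i x := by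
    intro i j hij x
    obtain ⟨y, rfl⟩ := (th i).surjective x
    let g : (op (op i) : ℕᵒᵖᵒᵖ) ⟶ op (op j) := (homOfLE hij).op.op
    have h3 := theta_tw I M b g y
    have h6 := LinearMap.congr_fun (congrArg ModuleCat.Hom.hom (cc.w g)) y
    have h4 : (th j).symm ((Tw I).map (homOfLE hij).op ≫ th i y) = _ :=
      (LinearEquiv.symm_apply_eq _).2 h3.symm
    have h5 : (th i).symm (th i y) = y := (th i).symm_apply_apply y
    refine (congrArg (cc.ι.app (op (op j))).hom h4).trans (h6.trans ?_)
    exact (congrArg (cc.ι.app (op (op i))).hom h5).symm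
  let ψ : Gm R (Tw I) (((Sg R).obj M)⟦(b:ℤ)⟧) →ₗ[R] cc.pt :=
    Module.DirectLimit.lift R ℕ _ _ ψn hψ
  have hψ2 : ∀ n f, ψ (Gmk R (Tw I) n f) = ψn n f := fun n f => Module.DirectLimit.lift_of _ _ _
  have e : Gm R (Tw I) (((Sg R).obj M)⟦(b:ℤ)⟧) ≃ₗ[R] cc.pt := by
    refine LinearEquiv.ofBijective ψ ⟨?_, ?_⟩
    · rw [← LinearMap.ker_eq_bot, LinearMap.ker_eq_bot']
      intro y hy
      obtain ⟨n, f, rfl⟩ := Gm_exists R (Tw I) y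
      rw [hψ2] at hy
      have h0 : (cc.ι.app (op (op n))).hom ((th n).symm f) = (cc.ι.app (op (op n))).hom 0 := by
        rw [map_zero]; exact hy
      obtain ⟨k, g, g', hg⟩ := Concrete.isColimit_exists_of_rep_eq _ hc _ _ h0
      have h1 := theta_tw I M b g ((th n).symm f)
      have h2 : ((localCohomology.diagram (localCohomology.idealPowersDiagram I) b).map g).app M ((th n).symm f) = 0 :=
        hg.trans (map_zero (((localCohomology.diagram (localCohomology.idealPowersDiagram I) b).map g').app M).hom)
      have h1' := h1.symm.trans ((congrArg (theta ((localCohomology.ringModIdeals (localCohomology.idealPowersDiagram I)).obj k.unop) M b) h2).trans (map_zero (theta ((localCohomology.ringModIdeals (localCohomology.idealPowersDiagram I)).obj k.unop) M b)))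
      have h3 : theta ((localCohomology.ringModIdeals (localCohomology.idealPowersDiagram I)).obj (op n)) M b ((th n).symm f) = f := (th n).apply_symm_apply f
      have h4 : (Tw I).map g.unop ≫ f = 0 := (congrArg ((Tw I).map g.unop ≫ ·) h3).symm.trans h1'
      have hle : n ≤ k.unop.unop := leOfHom g.unop.unop
      rw [← Gmk_map R (Tw I) hle f]
      exact (congrArg (Gmk R (Tw I) k.unop.unop) h4).trans (map_zero _)
    · intro y
      obtain ⟨j, x, rfl⟩ := Concrete.isColimit_exists_rep _ hc y
      refine ⟨Gmk R (Tw I) j.unop.unop (th j.unop.unop x), ?_⟩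
      rw [hψ2]
      exact congrArg (cc.ι.app j).hom ((th j.unop.unop).symm_apply_apply x)
  exact ⟨e.symm⟩

end CofPf

set_option linter.unusedSectionVars false

namespace CofPf
open CategoryTheory Limits Pretriangulated Opposite IsLocalRing

section e3
variable {R : Type u} [CommRing R]

/-- local cohomology at `J` -/
abbrev HH (J : Ideal R) (j : ℤ) (N : ModuleCat.{u} R) := Gm R (Tw J) (((Sg R).obj N)⟦j⟧)

lemma les2 {S : ShortComplex (ModuleCat.{u} R)} (hS : S.ShortExact) (J : Ideal R) (j : ℤ)
    (y : HH J j S.X₂) (hy : Gmap R (Tw J) (((Sg R).map S.g)⟦j⟧') y = 0) :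
    ∃ x, Gmap R (Tw J) (((Sg R).map S.f)⟦j⟧') x = y := by
  obtain ⟨δ, hT⟩ := ses_tri hS
  exact Gm_exact R _ _ _ (fun _ f hf => hex2 hT j f hf) y hy

lemma les_conn {S : ShortComplex (ModuleCat.{u} R)} (hS : S.ShortExact) (J : Ideal R) (j j' : ℤ)
    (hj : 1 + j = j') (h2 : Subsingleton (HH J j S.X₂)) (h2' : Subsingleton (HH J j' S.X₂)) :
    Nonempty (HH J j S.X₃ ≃ₗ[R] HH J j' S.X₁) := by
  obtain ⟨δ, hT⟩ := ses_tri hS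
  refine ⟨LinearEquiv.ofBijective (Gmap R (Tw J) (dl δ j j' hj)) ⟨?_, ?_⟩⟩
  · rw [injective_iff_map_eq_zero]
    intro y hy
    obtain ⟨x, hx⟩ := Gm_exact R (Tw J) (((Sg R).map S.g)⟦j⟧') (dl δ j j' hj)
      (fun _ f hf => hex3 hT j j' hj f hf) y hy
    rw [← hx, Subsingleton.elim x 0, map_zero]
  · intro y
    exact Gm_exact R (Tw J) (dl δ j j' hj) (((Sg R).map S.f)⟦j'⟧')
      (fun _ f hf => hex1 hT j j' hj f hf) y (Subsingleton.elim _ _)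

lemma les_quot {S : ShortComplex (ModuleCat.{u} R)} (hS : S.ShortExact) (J : Ideal R) (j j' : ℤ)
    (hj : 1 + j = j') (h2 : Subsingleton (HH J j S.X₁)) (h2' : Subsingleton (HH J j' S.X₁)) :
    Nonempty (HH J j S.X₂ ≃ₗ[R] HH J j S.X₃) := by
  obtain ⟨δ, hT⟩ := ses_tri hS
  refine ⟨LinearEquiv.ofBijective (Gmap R (Tw J) (((Sg R).map S.g)⟦j⟧')) ⟨?_, ?_⟩⟩
  · rw [injective_iff_map_eq_zero]
    intro y hy
    obtain ⟨x, hx⟩ := les2 hS J j y hy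
    rw [← hx, Subsingleton.elim x 0, map_zero]
  · intro y
    exact Gm_exact R (Tw J) (((Sg R).map S.g)⟦j⟧') (dl δ j j' hj)
      (fun _ f hf => hex3 hT j j' hj f hf) y (Subsingleton.elim _ _)

lemma les_sub {S : ShortComplex (ModuleCat.{u} R)} (hS : S.ShortExact) (J : Ideal R) (j j' : ℤ)
    (hj : 1 + j = j') (h2' : Subsingleton (HH J j' S.X₁))
    (hs : ∀ y : HH J j S.X₂, ∃ x, Gmap R (Tw J) (((Sg R).map S.f)⟦j⟧') x = y) :
    Subsingleton (HH J j S.X₃) := by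
  obtain ⟨δ, hT⟩ := ses_tri hS
  refine subsingleton_of_forall_eq 0 fun y => ?_
  obtain ⟨x, hx⟩ := Gm_exact R (Tw J) (((Sg R).map S.g)⟦j⟧') (dl δ j j' hj)
      (fun _ f hf => hex3 hT j j' hj f hf) y (Subsingleton.elim _ _)
  obtain ⟨z, rfl⟩ := hs x
  rw [← hx, ← Gmap_comp, ← Functor.map_comp, ← Functor.map_comp, S.zero, Functor.map_zero,
    Functor.map_zero, Gmap_zero]

/-- the torsion submodule -/
def Gam (I : Ideal R) (N : Type v) [AddCommGroup N] [Module R N] : Submodule R N where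
  carrier := {x | ∃ n, ∀ a ∈ I ^ n, a • x = 0}
  zero_mem' := ⟨0, fun a _ => smul_zero a⟩
  add_mem' := by
    rintro x y ⟨n, hn⟩ ⟨m, hm⟩
    refine ⟨n + m, fun a ha => ?_⟩
    rw [smul_add, hn a (Ideal.pow_le_pow_right (Nat.le_add_right _ _) ha),
      hm a (Ideal.pow_le_pow_right (Nat.le_add_left _ _) ha), add_zero]
  smul_mem' := by
    rintro r x ⟨n, hn⟩
    exact ⟨n, fun a ha => by rw [smul_comm, hn a ha, smul_zero]⟩

lemma Gam_tor (I : Ideal R) (N : Type v) [AddCommGroup N] [Module R N] : Tor I (Gam I N) := by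
  rintro ⟨x, n, hn⟩
  exact ⟨n, fun a ha => Subtype.ext (hn a ha)⟩

/-- `Γ` as degree zero local cohomology -/
lemma Gam_equiv (I : Ideal R) (N : ModuleCat.{u} R) : Nonempty (HH I 0 N ≃ₗ[R] Gam I N) := by
  refine ⟨LinearEquiv.ofBijective ((Gev I N).codRestrict (Gam I N) (fun g => Gev_tor I N g)) ⟨?_, ?_⟩⟩
  · intro a b h
    exact Gev_inj I N (congrArg Subtype.val h)
  · rintro ⟨x, n, hn⟩
    obtain ⟨g, hg⟩ := Gev_surj I N x n hn
    exact ⟨g, Subtype.ext hg⟩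

lemma Gam_surj {I J : Ideal R} (hIJ : I ≤ J) (N : ModuleCat.{u} R) (y : HH J 0 N) :
    ∃ x, Gmap R (Tw J) (((Sg R).map (scQ (B := N) (Gam I N)).f)⟦(0:ℤ)⟧') x = y := by
  obtain ⟨n, hn⟩ := Gev_tor J N y
  have hm : Gev J N y ∈ Gam I N := ⟨n, fun a ha => hn a (Ideal.pow_right_mono hIJ n ha)⟩
  obtain ⟨x, hx⟩ := Gev_surj J (ModuleCat.of R (Gam I N)) ⟨_, hm⟩ n
    (fun a ha => Subtype.ext (hn a ha))
  refine ⟨x, Gev_inj J N ?_⟩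
  refine (Gev_post J (scQ (B := N) (Gam I N)).f x).trans ?_
  exact (congrArg (scQ (B := N) (Gam I N)).f.hom hx)

lemma Gam_baer [IsNoetherianRing R] (I : Ideal R) {Q : Type u} [AddCommGroup Q] [Module R Q]
    (hQ : Module.Baer R Q) : Module.Baer R (Gam I Q) := by
  intro J g
  obtain ⟨n0, hn0⟩ := tor_map (Gam_tor I Q) g
  obtain ⟨k, hk⟩ := Ideal.exists_pow_inf_eq_pow_smul I (M := R) (J : Submodule R R)
  have hAR : ∀ x (hx : x ∈ J), x ∈ I ^ (k + n0) → g ⟨x, hx⟩ = 0 := by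
    intro x hxJ hx
    apply hn0
    have h1 : x ∈ I ^ (k + n0) • ⊤ ⊓ (J : Submodule R R) := ⟨by simpa using hx, hxJ⟩
    rw [hk _ (Nat.le_add_right _ _), Nat.add_sub_cancel_left] at h1
    have h2 : x ∈ I ^ n0 • (J : Submodule R R) := Submodule.smul_mono le_rfl inf_le_right h1
    have h3 : (I ^ n0 • ⊤ : Submodule R J).map (Submodule.subtype J) =
        I ^ n0 • (J : Submodule R R) := by
      rw [Submodule.map_smul'', Submodule.map_top, Submodule.range_subtype]
    rw [← h3] at h2
    obtain ⟨y, hy, hyx⟩ := h2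
    have : y = ⟨x, hxJ⟩ := Subtype.ext hyx
    rwa [← this]
  let β : J →ₗ[R] R ⧸ (I ^ (k + n0)) := (Submodule.mkQ (I ^ (k + n0))).comp (Submodule.subtype J)
  obtain ⟨h', hh'⟩ := baer_exact hQ (LinearMap.ker β).subtype β (fun b hb => ⟨⟨b, hb⟩, rfl⟩)
    ((Gam I Q).subtype.comp g) (by
      rintro ⟨⟨x, hxJ⟩, hx⟩
      have : x ∈ I ^ (k + n0) := by
        have h : Submodule.mkQ (I ^ (k + n0)) x = 0 := hx
        exact (Submodule.Quotient.mk_eq_zero _).mp h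
      show ((g ⟨x, hxJ⟩ : Gam I Q) : Q) = 0
      rw [hAR x hxJ this]; rfl)
  refine ⟨(h'.comp (Submodule.mkQ (I ^ (k + n0)))).codRestrict (Gam I Q) ?_, ?_⟩
  · intro x
    refine ⟨k + n0, fun a ha => ?_⟩
    rw [← map_smul]
    have : Submodule.mkQ (I ^ (k + n0)) (a • x) = 0 := by
      rw [Submodule.mkQ_apply, Submodule.Quotient.mk_eq_zero]
      exact Ideal.mul_mem_right _ _ ha
    show h' (Submodule.mkQ (I ^ (k + n0)) (a • x)) = 0
    rw [this, map_zero]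
  · intro x hx
    exact Subtype.ext (hh' ⟨x, hx⟩)

lemma T_zero [IsNoetherianRing R] {I J : Ideal R} (hIJ : I ≤ J) (Q : ModuleCat.{u} R)
    [hQ : Injective Q] (j : ℤ) (hj : 0 ≤ j) :
    Subsingleton (HH J j (ModuleCat.of R (Q ⧸ Gam I Q))) := by
  have hi : Injective (ModuleCat.of R (Gam I Q)) :=
    injective_obj_of_baer _ (Gam_baer I (baer_of_injective_obj Q))
  refine les_sub (scQ_exact (B := Q) (Gam I Q)) J j _ rfl (Gm_inj J (ModuleCat.of R (Gam I Q)) _ (by omega)) ?_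
  rcases hj.eq_or_lt with rfl | hj
  · exact Gam_surj hIJ Q
  · intro y
    have := Gm_inj J Q j hj
    exact ⟨0, Subsingleton.elim _ _⟩

lemma claim [IsNoetherianRing R] [IsLocalRing R] {I P : Ideal R} (hI : I ≤ maximalIdeal R)
    (hP : P.IsPrime) (k : ℕ) : ∀ N : ModuleCat.{u} R,
    (∀ b : ℕ, b ≤ k → ∀ L : ModuleCat.{u} R, Nonempty (L ≃ₗ[R] HH I b N) →
      Kill P (GG ((k - b : ℕ) : ℤ) ((Sg R).obj L))) → Kill P (GG (k : ℤ) ((Sg R).obj N)) := by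
  induction k with
  | zero => 
    intro N h
    have hS := scQ_exact (B := N) (Gam I N)
    obtain ⟨e⟩ := Gam_equiv I N
    have h0 := h 0 le_rfl (ModuleCat.of R (Gam I N)) ⟨e.symm⟩
    have hz : Subsingleton (HH (maximalIdeal R) 0 (ModuleCat.of R (N ⧸ Gam I N))) := by
      have h1 : Subsingleton (HH I 0 (ModuleCat.of R (N ⧸ Gam I N))) :=
        les_sub hS I 0 _ rfl (Gm_torsion I (ModuleCat.of R (Gam I N)) (Gam_tor I N) _ (by omega)) (Gam_surj le_rfl N)
      refine subsingleton_of_forall_eq 0 fun y => ?_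
      obtain ⟨n, hn⟩ := Gev_tor (maximalIdeal R) _ y
      obtain ⟨g, hg⟩ := Gev_surj I _ _ n fun a ha => hn a (Ideal.pow_right_mono hI n ha)
      apply Gev_inj
      rw [← hg, Subsingleton.elim g 0, map_zero, map_zero]
    exact Kill.mid hP h0 (Kill.of_subsingleton hP.ne_top (A := HH (maximalIdeal R) 0 (ModuleCat.of R (N ⧸ Gam I N)))) _ _ (les2 hS (maximalIdeal R) 0)
  | succ k ih =>
    intro N h
    have hS := scQ_exact (B := N) (Gam I N)
    obtain ⟨e⟩ := Gam_equiv I N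
    have h0 := h 0 (Nat.zero_le _) (ModuleCat.of R (Gam I N)) ⟨e.symm⟩
    have h1 : Subsingleton (HH I 0 (ModuleCat.of R (N ⧸ Gam I N))) :=
      les_sub hS I 0 _ rfl (Gm_torsion I (ModuleCat.of R (Gam I N)) (Gam_tor I N) _ (by omega)) (Gam_surj le_rfl N)
    suffices hN1 : Kill P (HH (maximalIdeal R) (k + 1 : ℕ) (ModuleCat.of R (N ⧸ Gam I N))) from
      Kill.mid hP h0 hN1 _ _ (les2 hS (maximalIdeal R) (k + 1 : ℕ))
    let N1 : ModuleCat.{u} R := ModuleCat.of R (N ⧸ Gam I N)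
    let Q : ModuleCat.{u} R := Injective.under N1
    let ι : N1 →ₗ[R] Q := (Injective.ι N1).hom
    have hι : Function.Injective ι := (ModuleCat.mono_iff_injective (Injective.ι N1)).mp inferInstance
    let f : N1 →ₗ[R] (Q ⧸ Gam I Q) := (Gam I Q).mkQ.comp ι
    have hf : Function.Injective f := by
      rw [injective_iff_map_eq_zero]
      intro x hx
      have hx' : ι x ∈ Gam I Q := by simpa [f] using hx
      obtain ⟨n, hn⟩ := hx'
      obtain ⟨g, hg⟩ := Gev_surj I N1 x n fun a ha => hι (by rw [map_smul, hn a ha, map_zero])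
      rw [← hg, Subsingleton.elim g 0, map_zero]
    have hS2 := scM_exact f (LinearMap.range f).mkQ (fun x => by simp) hf
      (Submodule.mkQ_surjective _) (fun y hy => by simpa using hy)
    have hS1 : ∀ b : ℕ, Nonempty (HH I b (ModuleCat.of R ((Q ⧸ Gam I Q) ⧸ LinearMap.range f)) ≃ₗ[R] HH I (b + 1 : ℕ) N1) :=
      fun b => les_conn hS2 I b (b + 1 : ℕ) (by push_cast; ring)
        (T_zero le_rfl Q b (by omega)) (T_zero le_rfl Q _ (by omega))
    obtain ⟨e2⟩ : Nonempty (HH (maximalIdeal R) k (ModuleCat.of R ((Q ⧸ Gam I Q) ⧸ LinearMap.range f)) ≃ₗ[R] HH (maximalIdeal R) (k + 1 : ℕ) N1) :=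
      les_conn hS2 (maximalIdeal R) k (k + 1 : ℕ) (by push_cast; ring)
        (T_zero hI Q k (by omega)) (T_zero hI Q _ (by omega))
    refine Kill.of_equiv (ih _ ?_) e2
    rintro b hb L ⟨eL⟩
    obtain ⟨e3⟩ := hS1 b
    obtain ⟨e4⟩ : Nonempty (HH I (b + 1 : ℕ) N ≃ₗ[R] HH I (b + 1 : ℕ) N1) :=
      les_quot hS I (b + 1 : ℕ) _ rfl (Gm_torsion I (ModuleCat.of R (Gam I N)) (Gam_tor I N) _ (by omega))
        (Gm_torsion I (ModuleCat.of R (Gam I N)) (Gam_tor I N) _ (by omega))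
    have := h (b + 1) (by omega) L ⟨eL.trans (e3.trans e4.symm)⟩
    rwa [Nat.add_sub_add_right] at this

end e3
end CofPf

set_option linter.unusedSectionVars false

namespace CofPf
open CategoryTheory Limits Pretriangulated Opposite IsLocalRing

section e4
variable {R : Type u} [CommRing R]

lemma HH_kill (J : Ideal R) (j : ℤ) (N : ModuleCat.{u} R) (s : R) (hs : ∀ x : N, s • x = 0)
    (g : HH J j N) : s • g = 0 := by
  have h0 : s • 𝟙 N = 0 := ModuleCat.hom_ext (LinearMap.ext fun x => hs x)
  have h1 : s • 𝟙 (((Sg R).obj N)⟦j⟧) = 0 := by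
    have h2 : s • 𝟙 ((Sg R).obj N) = 0 := by
      rw [← CategoryTheory.Functor.map_id, ← Functor.map_smul, h0, Functor.map_zero]
    rw [← CategoryTheory.Functor.map_id, ← Functor.map_smul, h2, Functor.map_zero]
  have h3 := Gmap_smul R (Tw J) s (𝟙 (((Sg R).obj N)⟦j⟧)) g
  rw [h1, Gmap_zero, Gmap_id] at h3
  exact h3.symm

lemma dd_const [IsLocalRing R] [IsNoetherianRing R] [IsAdicComplete (maximalIdeal R) R]
    {I P : Ideal R} (hI : I ≤ maximalIdeal R) (hP : P.IsPrime)
    (hcof : ∀ b : ℕ, Phi I ((Sg R).obj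
      ((localCohomology I b).obj (ModuleCat.of R (R ⧸ P))))) :
    ∃ a : ℕ, ∀ q : Ideal R, q.IsPrime → I ≤ q → P ≤ q →
      (∀ Q : Ideal R, Q.IsPrime → I ≤ Q → P ≤ Q → Q ≤ q → Q = q) → dd q = a := by
  by_contra hcon
  push Not at hcon
  refine not_kill hP (kill_VG ?_)
  refine claim hI hP (dd P) _ ?_
  rintro b hb L ⟨eL⟩
  obtain ⟨q, hq, hIq, hPq, hmin, hne⟩ := hcon (dd P - b)
  obtain ⟨e⟩ := lc_equiv I (ModuleCat.of R (R ⧸ P)) b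
  refine kill_GV (Kill.mono (kill_cofinite hI hq hIq hmin _ ?_ L ?_ ?_ ?_) hPq)
  · intro h
    exact hne (by exact_mod_cast h.symm)
  · intro x
    obtain ⟨n, hn⟩ := Gm_tor I _ (eL x)
    exact ⟨n, fun a ha => eL.injective (by rw [map_smul, hn a ha, map_zero])⟩
  · intro s hs x
    refine eL.injective ?_
    rw [map_smul, map_zero]
    refine HH_kill I _ _ s (fun x => ?_) _
    obtain ⟨r, rfl⟩ := Ideal.Quotient.mk_surjective (I := P) x
    show s • (Ideal.Quotient.mk P r) = 0
    rw [Algebra.smul_def, Ideal.Quotient.algebraMap_eq, ← map_mul]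
    exact Ideal.Quotient.eq_zero_iff_mem.mpr (P.mul_mem_right _ hs)
  · exact phi_iso ((Sg R).mapIso (e.trans eL.symm).toModuleIso) (hcof b)

lemma final [IsLocalRing R] [IsNoetherianRing R] [IsAdicComplete (maximalIdeal R) R]
    (I p : Ideal R) (hp : p.IsPrime)
    (hcof : ∀ b : ℕ, Phi I ((Sg R).obj
      ((localCohomology I b).obj (ModuleCat.of R (R ⧸ p))))) :
    {q : Ideal R | q ∈ associatedPrimes R (R ⧸ (p + I)) ∧
      ∀ q' ∈ associatedPrimes R (R ⧸ (p + I)), q' ≤ q → q' = q} =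
    {q : Ideal R | q ∈ associatedPrimes R (R ⧸ (p + I)) ∧
      ringKrullDim (R ⧸ q) = ringKrullDim (R ⧸ (p + I))} := by
  have hle : ∀ q ∈ associatedPrimes R (R ⧸ (p + I)), p + I ≤ q := by
    intro q hq
    have := IsAssociatedPrime.annihilator_le hq
    rwa [Submodule.annihilator_top, Ideal.annihilator_quotient] at this
  have hminass : ∀ q ∈ (p + I).minimalPrimes, q ∈ associatedPrimes R (R ⧸ (p + I)) := by
    intro q hq
    apply Module.associatedPrimes.minimalPrimes_annihilator_subset_associatedPrimes R (R ⧸ (p + I))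
    rwa [Ideal.annihilator_quotient]
  by_cases hI : I = ⊤
  · have : associatedPrimes R (R ⧸ (p + I)) = ∅ := by
      refine Set.eq_empty_of_forall_notMem fun q hq => ?_
      have h1 := hle q hq
      rw [hI, Ideal.add_eq_sup, sup_top_eq, top_le_iff] at h1
      exact hq.isPrime.ne_top h1
    ext q
    exact ⟨fun h => absurd (this ▸ h.1) (Set.notMem_empty q),
      fun h => absurd (this ▸ h.1) (Set.notMem_empty q)⟩
  have hIm : I ≤ maximalIdeal R := le_maximalIdeal hI
  have hpI : p + I ≠ ⊤ := by
    have : p + I ≤ maximalIdeal R := sup_le (le_maximalIdeal hp.ne_top) hIm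
    exact fun h => (maximalIdeal.isMaximal R).ne_top (top_le_iff.mp (h ▸ this))
  obtain ⟨a, ha⟩ := dd_const hIm hp hcof
  have hamin : ∀ q ∈ (p + I).minimalPrimes, dd q = a := by
    intro q hq
    refine ha q hq.1.1 (le_sup_right.trans hq.1.2) (le_sup_left.trans hq.1.2) ?_
    intro Q hQ hIQ hpQ hQq
    exact le_antisymm hQq (hq.2 ⟨hQ, sup_le hpQ hIQ⟩ hQq)
  have hdd : dd (p + I) = a := by
    obtain ⟨Q, hQ, hQle, hQd⟩ := exists_prime_dim (p + I) hpI
    obtain ⟨q, hq, hqQ⟩ := Ideal.exists_minimalPrimes_le hQle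
    have h1 := dd_le hQ.ne_top hqQ
    have h2 := dd_le hq.1.1.ne_top hq.1.2
    have h3 := hamin q hq
    omega
  ext q
  refine and_congr_right (fun hq : q ∈ associatedPrimes R (R ⧸ (p + I)) => ?_)
  have hqp : q.IsPrime := hq.isPrime
  rw [dd_coe q hqp.ne_top, dd_coe _ hpI, hdd]
  constructor
  · intro h
    obtain ⟨q', hq', hle'⟩ := Ideal.exists_minimalPrimes_le (hle q hq)
    rw [← h q' (hminass q' hq') hle', hamin q' hq']
  · intro h q' hq' hle'
    by_contra hne
    have h1 := dd_lt hq'.isPrime hqp (lt_of_le_of_ne hle' hne)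
    have h2 := dd_le hq'.isPrime.ne_top (hle q' hq')
    have h3 : dd q = a := by exact_mod_cast h
    omega

end e4
end CofPf

/-- Let `(R, m)` be a Noetherian complete local ring and `I ∈ 𝓘(R)`.  Then
`mAss_R R/(p + I) = Assh_R R/(p + I)` for every prime ideal `p` of `R`: the minimal elements of
`Ass_R (R/(p+I))` are exactly the associated primes `q` with `dim R/q = dim R/(p+I)`. -/
theorem mAss_eq_assh {R : Type u} [CommRing R] [IsNoetherianRing R]
    [IsLocalRing R] [IsAdicComplete (IsLocalRing.maximalIdeal R) R] (I : Ideal R)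
    (hI : MemCofiniteClass R I) (p : Ideal R) (hp : p.IsPrime) :
    {q ∈ associatedPrimes R (R ⧸ (p + I)) |
        ∀ q' ∈ associatedPrimes R (R ⧸ (p + I)), q' ≤ q → q' = q} =
      {q ∈ associatedPrimes R (R ⧸ (p + I)) |
        ringKrullDim (R ⧸ q) = ringKrullDim (R ⧸ (p + I))} := by
  have hfin : Module.Finite R (ModuleCat.of R (R ⧸ p)) :=
    inferInstanceAs (Module.Finite R (R ⧸ p))
  exact CofPf.final I p hp fun b => CofPf.phi_of_ext I _ (hI (ModuleCat.of R (R ⧸ p)) hfin b).2
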